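/- There exist universal constants C1, C2, C3, C4 > 0 (independent of d, m, n and of the underlying distributions) such that the following holds. Let P, Q be Borel probability measures on ℝ^d satisfying the continuity assumption, let m, n ≥ 3, let X_1, …, X_m be i.i.d. with law P and, independently, Y_1, …, Y_n i.i.d. with law Q, and define the U-statistic U_CvM = (1/(m(m−1)n(n−1))) Σ_{i1 ≠ i2} Σ_{j1 ≠ j2} h_CvM(X_{i1}, X_{i2}; Y_{j1}, Y_{j2}). Then E[U_CvM] = W_d²(P,Q) and Var(U_CvM) ≤ C1·W_d²(P,Q)·(1/m + 1/n) + C2/m² + C3/n² + C4/(mn). -/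

import Mathlib

open MeasureTheory ProbabilityTheory Real
open scoped RealInnerProductSpace ENNReal BigOperators

noncomputable section

/-- The standard Gaussian measure on `ℝ^d = EuclideanSpace ℝ (Fin d)`. -/
def stdGaussian (d : ℕ) : Measure (EuclideanSpace ℝ (Fin d)) :=
  (Measure.pi fun _ : Fin d => gaussianReal 0 1).map
    ⇑(EuclideanSpace.equiv (Fin d) ℝ).symm

/-- The uniform (rotation-invariant) probability measure `λ` on the unit sphere
`S^{d-1} = {x : ‖x‖ = 1} ⊆ ℝ^d`, realized as a Borel measure on `ℝ^d` concentrated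
on the sphere: the pushforward of the standard Gaussian under `x ↦ ‖x‖⁻¹ • x`. -/
def sphereUniform (d : ℕ) : Measure (EuclideanSpace ℝ (Fin d)) :=
  (stdGaussian d).map fun x => ‖x‖⁻¹ • x

/-- `Ang u v = arccos (⟪u,v⟫ / (‖u‖ ‖v‖)) ∈ [0, π]`, the angle between two nonzero vectors. -/
def Ang {d : ℕ} (u v : EuclideanSpace ℝ (Fin d)) : ℝ :=
  Real.arccos (⟪u, v⟫ / (‖u‖ * ‖v‖))

/-- Law of the projection `x ↦ ⟪β, x⟫` under `P`. -/
def projLaw {d : ℕ} (P : Measure (EuclideanSpace ℝ (Fin d)))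
    (β : EuclideanSpace ℝ (Fin d)) : Measure ℝ :=
  P.map fun x => ⟪β, x⟫

/-- `F_{β,P}(t) = P {x : ⟪β,x⟫ ≤ t}`. -/
def projCDF {d : ℕ} (P : Measure (EuclideanSpace ℝ (Fin d)))
    (β : EuclideanSpace ℝ (Fin d)) (t : ℝ) : ℝ :=
  (P {x | ⟪β, x⟫ ≤ t}).toReal

/-- The squared Cramér–von Mises distance `W_d²(P,Q)` with weight `ϑ`:
`∫_{S^{d-1}} ∫_ℝ (F_{β,P}(t) - F_{β,Q}(t))² dH_β(t) dλ(β)` where `H_β` is the law of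
`x ↦ ⟪β,x⟫` under the mixture `ϑ•P + (1-ϑ)•Q`. -/
def cvmSq {d : ℕ} (ϑ : ℝ) (P Q : Measure (EuclideanSpace ℝ (Fin d))) : ℝ :=
  ∫ β, (∫ t, (projCDF P β t - projCDF Q β t) ^ 2
      ∂(projLaw (ENNReal.ofReal ϑ • P + ENNReal.ofReal (1 - ϑ) • Q) β))
    ∂(sphereUniform d)

/-- The continuity assumption: for `λ`-a.e. `β`, the pushforwards of `P` and `Q`
under `x ↦ ⟪β,x⟫` are atomless. -/
def ContinuityAssumption {d : ℕ} (P Q : Measure (EuclideanSpace ℝ (Fin d))) : Prop :=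
  ∀ᵐ β ∂(sphereUniform d),
    (∀ t : ℝ, projLaw P β {t} = 0) ∧ (∀ t : ℝ, projLaw Q β {t} = 0)

/-- The Cramér–von Mises kernel
`h_CvM(x₁,x₂;y₁,y₂) = 1/3 - Ang(x₁-y₁, x₂-y₁)/(2π) - Ang(y₁-x₁, y₂-x₁)/(2π)`. -/
def hCvM {d : ℕ} (x1 x2 y1 y2 : EuclideanSpace ℝ (Fin d)) : ℝ :=
  1 / 3 - Ang (x1 - y1) (x2 - y1) / (2 * π) - Ang (y1 - x1) (y2 - x1) / (2 * π)

/-- The two-sample `U`-statistic with kernel `h_CvM`: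
`U_CvM = (m(m-1)n(n-1))⁻¹ Σ_{i₁≠i₂} Σ_{j₁≠j₂} h_CvM(X_{i₁},X_{i₂};Y_{j₁},Y_{j₂})`. -/
def UCvM {d : ℕ} (m n : ℕ)
    (ω : (Fin m → EuclideanSpace ℝ (Fin d)) × (Fin n → EuclideanSpace ℝ (Fin d))) : ℝ :=
  ((m : ℝ) * ((m : ℝ) - 1) * ((n : ℝ) * ((n : ℝ) - 1)))⁻¹ *
    ∑ i1 : Fin m, ∑ i2 : Fin m, ∑ j1 : Fin n, ∑ j2 : Fin n,
      if i1 ≠ i2 ∧ j1 ≠ j2 then hCvM (ω.1 i1) (ω.1 i2) (ω.2 j1) (ω.2 j2) else 0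

lemma stdGaussian_eq' (d : ℕ) :
    _root_.stdGaussian d = ProbabilityTheory.stdGaussian (EuclideanSpace ℝ (Fin d)) := by
  rw [← map_pi_eq_stdGaussian]
  rfl

instance stdGaussian_isProb (d : ℕ) : IsProbabilityMeasure (_root_.stdGaussian d) := by
  rw [stdGaussian_eq']; infer_instance

lemma measurable_normalize (d : ℕ) :
    Measurable (fun x : EuclideanSpace ℝ (Fin d) => ‖x‖⁻¹ • x) := by fun_prop

instance sphereUniform_isProb (d : ℕ) : IsProbabilityMeasure (sphereUniform d) := by
  unfold sphereUniform
  exact Measure.isProbabilityMeasure_map (measurable_normalize d).aemeasurable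

/-- The pair of inner products as a continuous linear map. -/
def pairMap {d : ℕ} (u v : EuclideanSpace ℝ (Fin d)) : EuclideanSpace ℝ (Fin d) →L[ℝ] ℝ × ℝ :=
  (innerSL ℝ u).prod (innerSL ℝ v)

lemma pairMap_apply {d : ℕ} (u v x : EuclideanSpace ℝ (Fin d)) :
    pairMap u v x = (⟪u, x⟫, ⟪v, x⟫) := rfl

lemma gauss_pair_law {d d' : ℕ} (u v : EuclideanSpace ℝ (Fin d)) (u' v' : EuclideanSpace ℝ (Fin d'))
    (h1 : ⟪u, u⟫ = ⟪u', u'⟫) (h2 : ⟪u, v⟫ = ⟪u', v'⟫) (h3 : ⟪v, v⟫ = ⟪v', v'⟫) :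
    (_root_.stdGaussian d).map (pairMap u v) = (_root_.stdGaussian d').map (pairMap u' v') := by
  have key : ∀ (k : ℕ) (a b : EuclideanSpace ℝ (Fin k)) (L : StrongDual ℝ (ℝ × ℝ)),
      ‖L.comp (pairMap a b)‖ ^ 2 = L (1, 0) ^ 2 * ⟪a, a⟫ + 2 * (L (1, 0) * L (0, 1)) * ⟪a, b⟫
        + L (0, 1) ^ 2 * ⟪b, b⟫ := by
    intro k a b L
    have : L.comp (pairMap a b) = innerSL ℝ (L (1, 0) • a + L (0, 1) • b) := by
      ext x
      have : pairMap a b x = ⟪a, x⟫ • ((1 : ℝ), (0 : ℝ)) + ⟪b, x⟫ • ((0 : ℝ), (1 : ℝ)) := by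
        simp [pairMap_apply]
      simp only [ContinuousLinearMap.comp_apply, this, map_add, map_smul, innerSL_apply_apply,
        inner_add_left, inner_smul_left, smul_eq_mul]
      simp [mul_comm]
    rw [this, innerSL_apply_norm, ← real_inner_self_eq_norm_sq]
    simp only [inner_add_left, inner_add_right, inner_smul_left, inner_smul_right]
    rw [real_inner_comm a b]
    simp
    ring
  have : IsProbabilityMeasure ((_root_.stdGaussian d).map (pairMap u v)) :=
    Measure.isProbabilityMeasure_map (pairMap u v).continuous.measurable.aemeasurable
  have : IsProbabilityMeasure ((_root_.stdGaussian d').map (pairMap u' v')) :=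
    Measure.isProbabilityMeasure_map (pairMap u' v').continuous.measurable.aemeasurable
  apply Measure.ext_of_charFunDual
  ext L
  rw [charFunDual_map, charFunDual_map, stdGaussian_eq', stdGaussian_eq', charFunDual_stdGaussian,
    charFunDual_stdGaussian]
  have := (key d u v L).trans ((by rw [h1, h2, h3] : _ = _).trans (key d' u' v' L).symm)
  have h' : ((‖L.comp (pairMap u v)‖ : ℂ)) ^ 2 = ((‖L.comp (pairMap u' v')‖ : ℂ)) ^ 2 := by
    exact_mod_cast this
  rw [h']

lemma gauss_prod_sector (φ : ℝ) (h0 : 0 ≤ φ) (h1 : φ ≤ π) :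
    ((gaussianReal 0 1).prod (gaussianReal 0 1)).real
      {p : ℝ × ℝ | 0 ≤ cos (φ / 2) * p.1 - sin (φ / 2) * p.2 ∧
        0 ≤ cos (φ / 2) * p.1 + sin (φ / 2) * p.2} = 1 / 2 - φ / (2 * π) := by
  set S := {p : ℝ × ℝ | 0 ≤ cos (φ / 2) * p.1 - sin (φ / 2) * p.2 ∧
        0 ≤ cos (φ / 2) * p.1 + sin (φ / 2) * p.2} with hS
  have hSm : MeasurableSet S := by
    apply MeasurableSet.inter
    · exact measurableSet_le (f := fun _ : ℝ × ℝ => (0 : ℝ))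
        (g := fun p : ℝ × ℝ => cos (φ / 2) * p.1 - sin (φ / 2) * p.2) (by fun_prop) (by fun_prop)
    · exact measurableSet_le (f := fun _ : ℝ × ℝ => (0 : ℝ))
        (g := fun p : ℝ × ℝ => cos (φ / 2) * p.1 + sin (φ / 2) * p.2) (by fun_prop) (by fun_prop)
  have hprod : (gaussianReal 0 1).prod (gaussianReal 0 1) =
      (volume : Measure (ℝ × ℝ)).withDensity
        (fun p => gaussianPDF 0 1 p.1 * gaussianPDF 0 1 p.2) := by
    rw [gaussianReal_of_var_ne_zero _ one_ne_zero, prod_withDensity (by fun_prop) (by fun_prop)]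
    rfl
  have e1 : ((gaussianReal 0 1).prod (gaussianReal 0 1)) S =
      ENNReal.ofReal (1 / 2 - φ / (2 * π)) := by
    rw [hprod, withDensity_apply _ hSm, ← lintegral_indicator hSm, ← lintegral_comp_polarCoord_symm]
    have tgt : polarCoord.target = Set.Ioi (0 : ℝ) ×ˢ Set.Ioo (-π) π := rfl
    have step : ∀ p ∈ polarCoord.target,
        ENNReal.ofReal p.1 • S.indicator (fun p => gaussianPDF 0 1 p.1 * gaussianPDF 0 1 p.2)
          (polarCoord.symm p) =
        ENNReal.ofReal (p.1 * rexp (-(1/2) * p.1 ^ 2)) *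
          (Set.Icc (-(π - φ) / 2) ((π - φ) / 2)).indicator
            (fun _ => ENNReal.ofReal (1 / (2 * π))) p.2 := by
      rintro ⟨r, t⟩ hp
      rw [tgt] at hp
      obtain ⟨hr, ht1, ht2⟩ := hp
      simp only [Set.mem_Ioi] at hr
      simp only at ht1 ht2
      have hmem : (polarCoord.symm (r, t) ∈ S) ↔ t ∈ Set.Icc (-(π - φ) / 2) ((π - φ) / 2) := by
        have q1 : cos (φ / 2) * (r * cos t) - sin (φ / 2) * (r * sin t) = r * cos (t + φ / 2) := by
          rw [cos_add]; ring
        have q2 : cos (φ / 2) * (r * cos t) + sin (φ / 2) * (r * sin t) = r * cos (t - φ / 2) := by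
          rw [cos_sub]; ring
        simp only [hS, polarCoord_symm_apply, Set.mem_ofPred_eq, q1, q2, mul_nonneg_iff_of_pos_left hr,
          Set.mem_Icc]
        constructor
        · rintro ⟨a, b⟩
          by_contra hcon
          rw [not_and_or, not_le, not_le] at hcon
          rcases hcon with hc | hc
          · have := cos_neg_of_pi_div_two_lt_of_lt (x := -(t - φ / 2)) (by linarith) (by linarith)
            rw [cos_neg] at this; linarith
          · have := cos_neg_of_pi_div_two_lt_of_lt (x := t + φ / 2) (by linarith) (by linarith)
            linarith
        · rintro ⟨a, b⟩
          exact ⟨cos_nonneg_of_neg_pi_div_two_le_of_le (by linarith) (by linarith),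
            cos_nonneg_of_neg_pi_div_two_le_of_le (by linarith) (by linarith)⟩
      by_cases hm : t ∈ Set.Icc (-(π - φ) / 2) ((π - φ) / 2)
      · rw [Set.indicator_of_mem (hmem.2 hm), Set.indicator_of_mem hm]
        simp only [polarCoord_symm_apply, gaussianPDF, gaussianPDFReal]
        rw [← ENNReal.ofReal_mul (by positivity), ← ENNReal.ofReal_mul (by positivity), smul_eq_mul,
          ← ENNReal.ofReal_mul hr.le]
        congr 1
        have hs : (√(2 * π))⁻¹ * (√(2 * π))⁻¹ = 1 / (2 * π) := by
          rw [← mul_inv, Real.mul_self_sqrt (by positivity), one_div]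
        have he : rexp (-(r * cos t) ^ 2 / 2) * rexp (-(r * sin t) ^ 2 / 2)
            = rexp (-(1/2) * r ^ 2) := by
          rw [← Real.exp_add]; congr 1
          have := sin_sq_add_cos_sq t
          linear_combination (-(r^2)/2) * this
        rw [← hs, ← he]
        simp
        ring
      · rw [Set.indicator_of_notMem (fun h => hm (hmem.1 h)), Set.indicator_of_notMem hm]
        simp
    rw [setLIntegral_congr_fun polarCoord.open_target.measurableSet step, tgt,
      Measure.volume_eq_prod, ← Measure.prod_restrict,
      lintegral_prod_mul (f := fun r : ℝ => ENNReal.ofReal (r * rexp (-(1/2) * r ^ 2)))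
        (g := (Set.Icc (-(π - φ) / 2) ((π - φ) / 2)).indicator
            (fun _ => ENNReal.ofReal (1 / (2 * π))))]
    · have i1 : ∫⁻ r in Set.Ioi (0:ℝ), ENNReal.ofReal (r * rexp (-(1/2) * r ^ 2)) = 1 := by
        rw [← ofReal_integral_eq_lintegral_ofReal]
        · have := integral_mul_cexp_neg_mul_sq (b := ((1/2 : ℝ) : ℂ)) (by norm_num)
          have h2 : ∫ r in Set.Ioi (0:ℝ), r * rexp (-(1/2) * r ^ 2) = 1 := by
            apply Complex.ofReal_injective
            rw [← integral_complex_ofReal]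
            push_cast at this ⊢
            rw [this]; norm_num
          rw [h2]; simp
        · exact (integrable_mul_exp_neg_mul_sq (by norm_num : (0:ℝ) < 1/2)).integrableOn
        · refine (ae_restrict_iff' measurableSet_Ioi).2 (Filter.Eventually.of_forall fun r hr => ?_)
          have : (0:ℝ) < r := hr
          positivity
      have i2 : ∫⁻ t in Set.Ioo (-π) π, (Set.Icc (-(π - φ) / 2) ((π - φ) / 2)).indicator
            (fun _ => ENNReal.ofReal (1 / (2 * π))) t = ENNReal.ofReal (1 / 2 - φ / (2 * π)) := by
        have hsub : Set.Icc (-(π - φ) / 2) ((π - φ) / 2) ⊆ Set.Ioo (-π) π := fun t ht =>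
          ⟨by linarith [ht.1, pi_pos], by linarith [ht.2, pi_pos]⟩
        rw [lintegral_indicator measurableSet_Icc, setLIntegral_const,
          Measure.restrict_apply measurableSet_Icc,
          Set.inter_eq_left.2 hsub,
          Real.volume_Icc, ← ENNReal.ofReal_mul (by positivity)]
        congr 1
        field_simp
        ring
      rw [i1, i2, one_mul]
    · fun_prop
    · exact (measurable_const.indicator measurableSet_Icc).aemeasurable
  rw [Measure.real, e1, ENNReal.toReal_ofReal]
  rw [sub_nonneg, div_le_div_iff₀ (by positivity) (by positivity)]
  linarith

lemma angle_gauss {d : ℕ} (u v : EuclideanSpace ℝ (Fin d)) (hu : u ≠ 0) (hv : v ≠ 0) :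
    (_root_.stdGaussian d).real {β | ⟪β, u⟫ ≤ 0 ∧ ⟪β, v⟫ ≤ 0} = 1 / 2 - Ang u v / (2 * π) := by
  set φ := Ang u v with hφ
  have hφ0 : 0 ≤ φ := arccos_nonneg _
  have hφ1 : φ ≤ π := arccos_le_pi _
  have hu' : 0 < ‖u‖ := norm_pos_iff.2 hu
  have hv' : 0 < ‖v‖ := norm_pos_iff.2 hv
  have hcos : ‖u‖ * ‖v‖ * cos φ = ⟪u, v⟫ := by
    have hab := abs_le.1 (abs_real_inner_div_norm_mul_norm_le_one u v)
    rw [hφ, Ang, cos_arccos hab.1 hab.2]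
    field_simp
  have hcc : cos φ = cos (φ / 2) ^ 2 - sin (φ / 2) ^ 2 := by
    rw [← cos_two_mul' (φ / 2)]; congr 1; ring
  have hone := sin_sq_add_cos_sq (φ / 2)
  set u' : EuclideanSpace ℝ (Fin 2) := !₂[-(‖u‖ * cos (φ / 2)), ‖u‖ * sin (φ / 2)] with hu'd
  set v' : EuclideanSpace ℝ (Fin 2) := !₂[-(‖v‖ * cos (φ / 2)), -(‖v‖ * sin (φ / 2))] with hv'd
  have hlaw := gauss_pair_law u v u' v' (by
      rw [real_inner_self_eq_norm_sq, hu'd, PiLp.inner_apply]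
      simp [-inner_self_eq_norm_sq_to_K, -real_inner_self_eq_norm_sq, PiLp.inner_apply, Fin.sum_univ_two]
      linear_combination (-‖u‖^2) * hone) (by
      rw [← hcos, hcc, hu'd, hv'd]
      simp [PiLp.inner_apply, Fin.sum_univ_two]
      ring) (by
      rw [real_inner_self_eq_norm_sq, hv'd, PiLp.inner_apply]
      simp [-inner_self_eq_norm_sq_to_K, -real_inner_self_eq_norm_sq, PiLp.inner_apply, Fin.sum_univ_two]
      linear_combination (-‖v‖^2) * hone)
  have hT : MeasurableSet (Set.Iic (0:ℝ) ×ˢ Set.Iic (0:ℝ)) := measurableSet_Iic.prod measurableSet_Iic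
  have h1 := congrArg (fun μ => μ (Set.Iic (0:ℝ) ×ˢ Set.Iic (0:ℝ))) hlaw
  rw [Measure.map_apply (pairMap u v).continuous.measurable hT,
    Measure.map_apply (pairMap u' v').continuous.measurable hT] at h1
  have h2 : {β : EuclideanSpace ℝ (Fin d) | ⟪β, u⟫ ≤ 0 ∧ ⟪β, v⟫ ≤ 0}
      = (pairMap u v) ⁻¹' (Set.Iic (0:ℝ) ×ˢ Set.Iic (0:ℝ)) := by
    ext β
    simp [pairMap_apply, real_inner_comm]
  rw [Measure.real, h2, h1, ← gauss_prod_sector φ hφ0 hφ1, Measure.real]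
  congr 1
  rw [_root_.stdGaussian, Measure.map_apply (EuclideanSpace.equiv (Fin 2) ℝ).symm.continuous.measurable
    ((pairMap u' v').continuous.measurable hT)]
  rw [← (measurePreserving_finTwoArrow (gaussianReal 0 1)).map_eq, MeasurableEquiv.map_apply]
  congr 1
  ext x
  simp only [Set.mem_preimage, pairMap_apply, Set.mem_prod, Set.mem_Iic, Set.mem_ofPred_eq]
  have a1 : ⟪u', (EuclideanSpace.equiv (Fin 2) ℝ).symm x⟫ =
      -(‖u‖ * (cos (φ / 2) * x 0 - sin (φ / 2) * x 1)) := by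
    rw [hu'd]; simp [PiLp.inner_apply, Fin.sum_univ_two]; ring
  have a2 : ⟪v', (EuclideanSpace.equiv (Fin 2) ℝ).symm x⟫ =
      -(‖v‖ * (cos (φ / 2) * x 0 + sin (φ / 2) * x 1)) := by
    rw [hv'd]; simp [PiLp.inner_apply, Fin.sum_univ_two]; ring
  rw [a1, a2, neg_nonpos, neg_nonpos, mul_nonneg_iff_of_pos_left hu', mul_nonneg_iff_of_pos_left hv']
  rfl

lemma measurableSet_le_inner {d : ℕ} (u : EuclideanSpace ℝ (Fin d)) :
    MeasurableSet {β : EuclideanSpace ℝ (Fin d) | ⟪β, u⟫ ≤ 0} :=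
  measurableSet_le (f := fun β : EuclideanSpace ℝ (Fin d) => ⟪β, u⟫) (by fun_prop) measurable_const

lemma angle_sphere {d : ℕ} (u v : EuclideanSpace ℝ (Fin d)) (hu : u ≠ 0) (hv : v ≠ 0) :
    (sphereUniform d).real {β | ⟪β, u⟫ ≤ 0 ∧ ⟪β, v⟫ ≤ 0} = 1 / 2 - Ang u v / (2 * π) := by
  have hm : MeasurableSet {β : EuclideanSpace ℝ (Fin d) | ⟪β, u⟫ ≤ 0 ∧ ⟪β, v⟫ ≤ 0} :=
    (measurableSet_le_inner u).inter (measurableSet_le_inner v)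
  rw [← angle_gauss u v hu hv, Measure.real, Measure.real, sphereUniform,
    Measure.map_apply (measurable_normalize d) hm]
  congr 2
  ext x
  have : ∀ w : EuclideanSpace ℝ (Fin d), ⟪‖x‖⁻¹ • x, w⟫ ≤ 0 ↔ ⟪x, w⟫ ≤ 0 := by
    intro w
    rcases eq_or_ne x 0 with rfl | hx
    · simp
    · have : 0 < ‖x‖⁻¹ := inv_pos.2 (norm_pos_iff.2 hx)
      rw [real_inner_smul_left]
      constructor
      · intro h; by_contra h'; push Not at h'; nlinarith [mul_pos this h']
      · intro h; exact mul_nonpos_of_nonneg_of_nonpos this.le h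
  simp only [Set.mem_preimage, Set.mem_ofPred_eq, this]

/-- indicator of `a ≤ b` -/
def kle (a b : ℝ) : ℝ := if a ≤ b then 1 else 0

lemma kle_nonneg (a b : ℝ) : 0 ≤ kle a b := by unfold kle; split_ifs <;> norm_num
lemma kle_le_one (a b : ℝ) : kle a b ≤ 1 := by unfold kle; split_ifs <;> norm_num

lemma measurable_kle : Measurable (fun p : ℝ × ℝ => kle p.1 p.2) := by
  unfold kle
  exact Measurable.ite (measurableSet_le measurable_fst measurable_snd) measurable_const
    measurable_const

lemma Measurable.kle' {α : Type*} [MeasurableSpace α] {f g : α → ℝ} (hf : Measurable f)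
    (hg : Measurable g) : Measurable (fun x => kle (f x) (g x)) :=
  measurable_kle.comp (hf.prodMk hg)

/-- bounded measurable functions are integrable -/
lemma integrable_bdd {α : Type*} [MeasurableSpace α] {μ : Measure α} [IsFiniteMeasure μ]
    {f : α → ℝ} (hf : Measurable f) (C : ℝ) (h : ∀ x, |f x| ≤ C) : Integrable f μ :=
  Integrable.of_bound hf.aestronglyMeasurable C (Filter.Eventually.of_forall h)

section OneD
variable {E : Type*} [MeasurableSpace E]

/-- cdf of `f` under `P` -/
def fcdf (P : Measure E) (f : E → ℝ) (t : ℝ) : ℝ := P.real {x | f x ≤ t}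

lemma fcdf_eq (P : Measure E) {f : E → ℝ} (hf : Measurable f) (t : ℝ) :
    fcdf P f t = ∫ x, kle (f x) t ∂P := by
  have hm : MeasurableSet {x | f x ≤ t} := measurableSet_le hf measurable_const
  rw [fcdf, ← integral_indicator_one hm]
  rfl

lemma fcdf_nonneg (P : Measure E) (f : E → ℝ) (t : ℝ) : 0 ≤ fcdf P f t := measureReal_nonneg

lemma fcdf_le_one (P : Measure E) [IsProbabilityMeasure P] (f : E → ℝ) (t : ℝ) : fcdf P f t ≤ 1 :=
  measureReal_le_one

lemma abs_fcdf_le (P : Measure E) [IsProbabilityMeasure P] (f : E → ℝ) (t : ℝ) :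
    |fcdf P f t| ≤ 1 := by
  rw [abs_of_nonneg (fcdf_nonneg P f t)]; exact fcdf_le_one P f t

lemma fcdf_measurable (P : Measure E) [IsProbabilityMeasure P] (f : E → ℝ) :
    Measurable (fcdf P f) := by
  apply Monotone.measurable
  intro s t h
  exact measureReal_mono (fun x hx => le_trans hx h)

lemma fcdf_star (P : Measure E) [IsProbabilityMeasure P] {f : E → ℝ} (hf : Measurable f)
    (hP : ∀ t, P {x | f x = t} = 0) (s : ℝ) :
    2 * ∫ y, kle s (f y) * fcdf P f (f y) ∂P = 1 - fcdf P f s ^ 2 := by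
  have hne : ∀ t, ∀ᵐ x ∂P, f x ≠ t := fun t => by
    rw [ae_iff]; simpa using hP t
  have h1 : ∫ y, kle s (f y) * fcdf P f (f y) ∂P
      = ∫ y, ∫ x, kle s (f y) * kle (f x) (f y) ∂P ∂P := by
    congr 1; ext y; rw [integral_const_mul, fcdf_eq P hf]
  have hm : Measurable (fun p : E × E => kle s (f p.1) * kle (f p.2) (f p.1)) :=
    (Measurable.kle' measurable_const (hf.comp measurable_fst)).mul
      (Measurable.kle' (hf.comp measurable_snd) (hf.comp measurable_fst))
  have hi : Integrable (fun p : E × E => kle s (f p.1) * kle (f p.2) (f p.1)) (P.prod P) :=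
    integrable_bdd hm 1 (fun p => by
      rw [abs_of_nonneg (mul_nonneg (kle_nonneg _ _) (kle_nonneg _ _))]
      exact mul_le_one₀ (kle_le_one _ _) (kle_nonneg _ _) (kle_le_one _ _))
  have h2 : ∫ y, ∫ x, kle s (f y) * kle (f x) (f y) ∂P ∂P
      = ∫ y, ∫ x, kle s (f x) * kle (f y) (f x) ∂P ∂P :=
    integral_integral_swap (f := fun y x => kle s (f y) * kle (f x) (f y)) hi
  have h3 : (∫ y, ∫ x, kle s (f y) * kle (f x) (f y) ∂P ∂P)
      + (∫ y, ∫ x, kle s (f x) * kle (f y) (f x) ∂P ∂P) =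
      ∫ y, ∫ x, (1 - kle (f y) s * kle (f x) s) ∂P ∂P := by
    have hi' : Integrable (fun p : E × E => kle s (f p.2) * kle (f p.1) (f p.2)) (P.prod P) :=
      hi.swap
    rw [← integral_add hi.integral_prod_left hi'.integral_prod_left]
    apply integral_congr_ae
    filter_upwards [hne s, hi.prod_right_ae, hi'.prod_right_ae] with y hy hiy hiy'
    rw [← integral_add hiy hiy']
    apply integral_congr_ae
    filter_upwards [hne s, hne (f y)] with x hx hxy
    simp only [kle]
    rcases lt_or_gt_of_ne hy with a | a <;> rcases lt_or_gt_of_ne hx with b | b <;>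
      rcases lt_or_gt_of_ne hxy with c | c <;>
      simp [a.le, b.le, c.le, not_le.2 a, not_le.2 b, not_le.2 c] <;> linarith
  have h4 : ∫ y, ∫ x, (1 - kle (f y) s * kle (f x) s) ∂P ∂P = 1 - fcdf P f s ^ 2 := by
    have hk : Integrable (fun x => kle (f x) s) P :=
      integrable_bdd (Measurable.kle' hf measurable_const) 1 (fun x => by
        rw [abs_of_nonneg (kle_nonneg _ _)]; exact kle_le_one _ _)
    have : ∀ y, ∫ x, (1 - kle (f y) s * kle (f x) s) ∂P = 1 - kle (f y) s * fcdf P f s := by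
      intro y
      rw [integral_sub (integrable_const _) (hk.const_mul _), integral_const_mul, ← fcdf_eq P hf]
      simp
    simp_rw [this]
    rw [integral_sub (integrable_const _) (hk.mul_const _), integral_mul_const, ← fcdf_eq P hf]
    simp [sq]
  rw [h1, two_mul]
  nth_rewrite 2 [h2]
  rw [h3, h4]

lemma fcdf_cross (P Q : Measure E) [IsProbabilityMeasure P] [IsProbabilityMeasure Q] {f : E → ℝ}
    (hf : Measurable f) (hP : ∀ t, P {x | f x = t} = 0) :
    2 * ∫ y, fcdf P f (f y) * fcdf Q f (f y) ∂P = 1 - ∫ z, fcdf P f (f z) ^ 2 ∂Q := by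
  have hF := (fcdf_measurable P f).comp hf
  have h1 : ∫ y, fcdf P f (f y) * fcdf Q f (f y) ∂P
      = ∫ y, ∫ z, kle (f z) (f y) * fcdf P f (f y) ∂Q ∂P := by
    congr 1; ext y; rw [integral_mul_const, ← fcdf_eq Q hf, mul_comm]
  have hi : Integrable (fun p : E × E => kle (f p.2) (f p.1) * fcdf P f (f p.1)) (P.prod Q) :=
    integrable_bdd ((Measurable.kle' (hf.comp measurable_snd) (hf.comp measurable_fst)).mul
      (hF.comp measurable_fst)) 1 (fun p => by
        rw [abs_of_nonneg (mul_nonneg (kle_nonneg _ _) (fcdf_nonneg _ _ _))]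
        exact mul_le_one₀ (kle_le_one _ _) (fcdf_nonneg _ _ _) (fcdf_le_one _ _ _))
  rw [h1, integral_integral_swap (f := fun y z => kle (f z) (f y) * fcdf P f (f y)) hi,
    ← integral_const_mul]
  simp_rw [fcdf_star P hf hP]
  rw [integral_sub (integrable_const _)]
  · simp
  · refine integrable_bdd (hF.pow_const 2) 1 (fun x => ?_)
    rw [abs_of_nonneg (sq_nonneg _)]
    exact pow_le_one₀ (fcdf_nonneg _ _ _) (fcdf_le_one _ _ _)

lemma fcdf_third (P : Measure E) [IsProbabilityMeasure P] {f : E → ℝ}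
    (hf : Measurable f) (hP : ∀ t, P {x | f x = t} = 0) :
    ∫ y, fcdf P f (f y) ^ 2 ∂P = 1 / 3 := by
  have := fcdf_cross P P hf hP
  simp_rw [← sq] at this
  linarith

lemma fcdf_mul_integrable (P Q R : Measure E) [IsProbabilityMeasure P] [IsProbabilityMeasure Q]
    [IsFiniteMeasure R] {f : E → ℝ} (hf : Measurable f) :
    Integrable (fun y => fcdf P f (f y) * fcdf Q f (f y)) R :=
  integrable_bdd (((fcdf_measurable P f).comp hf).mul ((fcdf_measurable Q f).comp hf)) 1 (fun p => by
        rw [abs_of_nonneg (mul_nonneg (fcdf_nonneg _ _ _) (fcdf_nonneg _ _ _))]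
        exact mul_le_one₀ (fcdf_le_one _ _ _) (fcdf_nonneg _ _ _) (fcdf_le_one _ _ _))

lemma fcdf_sq_integrable (P R : Measure E) [IsProbabilityMeasure P]
    [IsFiniteMeasure R] {f : E → ℝ} (hf : Measurable f) :
    Integrable (fun y => fcdf P f (f y) ^ 2) R := by
  simp_rw [sq]; exact fcdf_mul_integrable P P R hf

lemma fcdf_diff_sq_integrable (P Q R : Measure E) [IsProbabilityMeasure P] [IsProbabilityMeasure Q]
    [IsFiniteMeasure R] {f : E → ℝ} (hf : Measurable f) :
    Integrable (fun y => (fcdf P f (f y) - fcdf Q f (f y)) ^ 2) R := by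
  refine (((fcdf_sq_integrable P R hf).sub ((fcdf_mul_integrable P Q R hf).const_mul 2)).add
    (fcdf_sq_integrable Q R hf)).congr (Filter.Eventually.of_forall fun y => ?_)
  simp only [Pi.add_apply, Pi.sub_apply]
  ring

lemma fcdf_diff_left (P Q : Measure E) [IsProbabilityMeasure P] [IsProbabilityMeasure Q] {f : E → ℝ}
    (hf : Measurable f) (hP : ∀ t, P {x | f x = t} = 0) :
    ∫ y, (fcdf P f (f y) - fcdf Q f (f y)) ^ 2 ∂P =
      ∫ y, fcdf P f (f y) ^ 2 ∂Q + ∫ y, fcdf Q f (f y) ^ 2 ∂P - 2 / 3 := by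
  have h1 := fcdf_cross P Q hf hP
  have h2 := fcdf_third P hf hP
  have : ∀ y, (fcdf P f (f y) - fcdf Q f (f y)) ^ 2 =
      fcdf P f (f y) ^ 2 - 2 * (fcdf P f (f y) * fcdf Q f (f y)) + fcdf Q f (f y) ^ 2 := by
    intro y; ring
  simp_rw [this]
  rw [integral_add _ (fcdf_sq_integrable Q P hf),
    integral_sub (fcdf_sq_integrable P P hf) ((fcdf_mul_integrable P Q P hf).const_mul 2),
    integral_const_mul, h1, h2]
  · ring
  · exact (fcdf_sq_integrable P P hf).sub ((fcdf_mul_integrable P Q P hf).const_mul 2)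

lemma fcdf_diff_right (P Q : Measure E) [IsProbabilityMeasure P] [IsProbabilityMeasure Q] {f : E → ℝ}
    (hf : Measurable f) (hQ : ∀ t, Q {x | f x = t} = 0) :
    ∫ y, (fcdf P f (f y) - fcdf Q f (f y)) ^ 2 ∂Q =
      ∫ y, fcdf P f (f y) ^ 2 ∂Q + ∫ y, fcdf Q f (f y) ^ 2 ∂P - 2 / 3 := by
  have := fcdf_diff_left Q P hf hQ
  rw [add_comm (∫ y, fcdf P f (f y) ^ 2 ∂Q), ← this]
  congr 1; ext y; ring

lemma fcdf_diff_mix (P Q : Measure E) [IsProbabilityMeasure P] [IsProbabilityMeasure Q] {f : E → ℝ}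
    (hf : Measurable f) (hP : ∀ t, P {x | f x = t} = 0) (hQ : ∀ t, Q {x | f x = t} = 0)
    (ϑ : ℝ) (h : ϑ ∈ Set.Ioo (0 : ℝ) 1) :
    ∫ t, (fcdf P f t - fcdf Q f t) ^ 2
      ∂((ENNReal.ofReal ϑ • P + ENNReal.ofReal (1 - ϑ) • Q).map f) =
      ∫ y, fcdf P f (f y) ^ 2 ∂Q + ∫ y, fcdf Q f (f y) ^ 2 ∂P - 2 / 3 := by
  have hmeas : Measurable (fun t => (fcdf P f t - fcdf Q f t) ^ 2) :=
    ((fcdf_measurable P f).sub (fcdf_measurable Q f)).pow_const 2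
  rw [integral_map hf.aemeasurable hmeas.aestronglyMeasurable, integral_add_measure,
    integral_smul_measure, integral_smul_measure, fcdf_diff_left P Q hf hP,
    fcdf_diff_right P Q hf hQ, ENNReal.toReal_ofReal h.1.le,
    ENNReal.toReal_ofReal (by linarith [h.2]), smul_eq_mul, smul_eq_mul]
  · ring
  · exact (fcdf_diff_sq_integrable P Q P hf).smul_measure ENNReal.ofReal_ne_top
  · exact (fcdf_diff_sq_integrable P Q Q hf).smul_measure ENNReal.ofReal_ne_top

lemma sq_integral_le_bdd {μ : Measure E} [IsProbabilityMeasure μ] {g : E → ℝ}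
    (hg : Integrable g μ) (hg2 : Integrable (fun x => g x ^ 2) μ) :
    (∫ x, g x ∂μ) ^ 2 ≤ ∫ x, g x ^ 2 ∂μ := by
  set c := ∫ x, g x ∂μ with hc
  have h0 : 0 ≤ ∫ x, (g x - c) ^ 2 ∂μ := integral_nonneg fun x => sq_nonneg _
  have : ∀ x, (g x - c) ^ 2 = g x ^ 2 - 2 * c * g x + c ^ 2 := fun x => by ring
  simp_rw [this] at h0
  have hi : Integrable (fun x => g x ^ 2 - 2 * c * g x) μ := hg2.sub (hg.const_mul _)
  rw [integral_add hi (integrable_const _), integral_sub hg2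
    (hg.const_mul _), integral_const_mul, ← hc] at h0
  simp at h0
  nlinarith
end OneD

/-- the angle kernel -/
def angK {d : ℕ} (x1 x2 y : EuclideanSpace ℝ (Fin d)) : ℝ := Ang (x1 - y) (x2 - y) / (2 * π)

/-- indicator of `⟪β,x⟫ ≤ ⟪β,y⟫` -/
def kB {d : ℕ} (β x y : EuclideanSpace ℝ (Fin d)) : ℝ := kle ⟪β, x⟫ ⟪β, y⟫

/-- projected cdf at projected point -/
def cdfB {d : ℕ} (P : Measure (EuclideanSpace ℝ (Fin d))) (β y : EuclideanSpace ℝ (Fin d)) : ℝ :=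
  fcdf P (fun x => ⟪β, x⟫) ⟪β, y⟫

/-- `P` has no atoms along almost all projections -/
def NAP {d : ℕ} (P : Measure (EuclideanSpace ℝ (Fin d))) : Prop :=
  ∀ᵐ β ∂(sphereUniform d), ∀ t : ℝ, P {x | ⟪β, x⟫ = t} = 0

section
variable {d : ℕ}

lemma measurable_ang : Measurable (fun p : (EuclideanSpace ℝ (Fin d)) × (EuclideanSpace ℝ (Fin d)) => Ang p.1 p.2) := by
  unfold Ang
  exact Real.continuous_arccos.measurable.comp (by fun_prop)

lemma angK_symm (x1 x2 y : (EuclideanSpace ℝ (Fin d))) : angK x1 x2 y = angK x2 x1 y := by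
  unfold angK Ang
  rw [real_inner_comm, mul_comm ‖x1 - y‖]

lemma angK_nonneg (x1 x2 y : (EuclideanSpace ℝ (Fin d))) : 0 ≤ angK x1 x2 y :=
  div_nonneg (arccos_nonneg _) (by positivity)

lemma angK_le (x1 x2 y : (EuclideanSpace ℝ (Fin d))) : angK x1 x2 y ≤ 1 := by
  unfold angK
  rw [div_le_one (by positivity)]
  have : Ang (x1 - y) (x2 - y) ≤ π := arccos_le_pi _
  linarith [pi_pos]

lemma measurable_angK : Measurable (fun p : (EuclideanSpace ℝ (Fin d)) × (EuclideanSpace ℝ (Fin d)) × (EuclideanSpace ℝ (Fin d)) => angK p.1 p.2.1 p.2.2) := by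
  unfold angK
  exact (measurable_ang.comp (by fun_prop :
    Measurable (fun p : (EuclideanSpace ℝ (Fin d)) × (EuclideanSpace ℝ (Fin d)) × (EuclideanSpace ℝ (Fin d)) => (p.1 - p.2.2, p.2.1 - p.2.2)))).div_const _

lemma kB_nonneg (β x y : (EuclideanSpace ℝ (Fin d))) : 0 ≤ kB β x y := kle_nonneg _ _
lemma kB_le_one (β x y : (EuclideanSpace ℝ (Fin d))) : kB β x y ≤ 1 := kle_le_one _ _

lemma measurable_kB {α : Type*} [MeasurableSpace α] {f g h : α → (EuclideanSpace ℝ (Fin d))} (hf : Measurable f)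
    (hg : Measurable g) (hh : Measurable h) : Measurable (fun a => kB (f a) (g a) (h a)) := by
  unfold kB
  exact Measurable.kle' (hf.inner hg) (hf.inner hh)

lemma measurable_inner_left (β : (EuclideanSpace ℝ (Fin d))) : Measurable (fun x : (EuclideanSpace ℝ (Fin d)) => ⟪β, x⟫) := by fun_prop

lemma cdfB_eq (P : Measure (EuclideanSpace ℝ (Fin d))) (β y : (EuclideanSpace ℝ (Fin d))) : cdfB P β y = ∫ x, kB β x y ∂P :=
  fcdf_eq P (measurable_inner_left β) _

lemma cdfB_nonneg (P : Measure (EuclideanSpace ℝ (Fin d))) (β y : (EuclideanSpace ℝ (Fin d))) : 0 ≤ cdfB P β y := fcdf_nonneg _ _ _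

lemma cdfB_le_one (P : Measure (EuclideanSpace ℝ (Fin d))) [IsProbabilityMeasure P] (β y : (EuclideanSpace ℝ (Fin d))) : cdfB P β y ≤ 1 :=
  fcdf_le_one _ _ _

lemma measurable_cdfB (P : Measure (EuclideanSpace ℝ (Fin d))) [IsProbabilityMeasure P] :
    Measurable (fun p : (EuclideanSpace ℝ (Fin d)) × (EuclideanSpace ℝ (Fin d)) => cdfB P p.1 p.2) := by
  simp_rw [cdfB_eq]
  have : StronglyMeasurable (fun q : ((EuclideanSpace ℝ (Fin d)) × (EuclideanSpace ℝ (Fin d))) × (EuclideanSpace ℝ (Fin d)) => kB q.1.1 q.2 q.1.2) :=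
    (measurable_kB (by fun_prop) (by fun_prop) (by fun_prop)).stronglyMeasurable
  exact this.integral_prod_right.measurable

lemma measurable_cdfB' (P : Measure (EuclideanSpace ℝ (Fin d))) [IsProbabilityMeasure P] {α : Type*} [MeasurableSpace α]
    {f g : α → (EuclideanSpace ℝ (Fin d))} (hf : Measurable f) (hg : Measurable g) :
    Measurable (fun a => cdfB P (f a) (g a)) := by
  have h := hf.prodMk hg
  have := (measurable_cdfB P).comp h
  simpa only [Function.comp_def] using this

lemma NAP.noatom {P : Measure (EuclideanSpace ℝ (Fin d))} (h : NAP P) (x : (EuclideanSpace ℝ (Fin d))) : P {x} = 0 := by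
  obtain ⟨β, hβ⟩ := (Filter.Eventually.exists h : ∃ β, ∀ t : ℝ, P {x | ⟪β, x⟫ = t} = 0)
  refine measure_mono_null ?_ (hβ ⟪β, x⟫)
  intro z hz
  rw [Set.mem_singleton_iff] at hz
  simp [hz]

lemma NAP.ae_ne {P : Measure (EuclideanSpace ℝ (Fin d))} (h : NAP P) (x : (EuclideanSpace ℝ (Fin d))) : ∀ᵐ z ∂P, z ≠ x := by
  rw [ae_iff]; simpa using h.noatom x

lemma angK_eq (x1 x2 y : (EuclideanSpace ℝ (Fin d))) (h1 : x1 ≠ y) (h2 : x2 ≠ y) :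
    angK x1 x2 y = 1 / 2 - ∫ β, kB β x1 y * kB β x2 y ∂(sphereUniform d) := by
  have h := angle_sphere (x1 - y) (x2 - y) (sub_ne_zero.2 h1) (sub_ne_zero.2 h2)
  have hm : MeasurableSet {β : (EuclideanSpace ℝ (Fin d)) | ⟪β, x1 - y⟫ ≤ 0 ∧ ⟪β, x2 - y⟫ ≤ 0} :=
    (measurableSet_le_inner _).inter (measurableSet_le_inner _)
  rw [← integral_indicator_one hm] at h
  have e : ∫ β, kB β x1 y * kB β x2 y ∂(sphereUniform d) = 
      ∫ β, ({β : (EuclideanSpace ℝ (Fin d)) | ⟪β, x1 - y⟫ ≤ 0 ∧ ⟪β, x2 - y⟫ ≤ 0}).indicator 1 β ∂(sphereUniform d) := by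
    congr 1
    ext β
    simp only [kB, kle, Set.indicator, Set.mem_ofPred_eq, inner_sub_right, sub_nonpos, Pi.one_apply]
    by_cases a : ⟪β, x1⟫ ≤ ⟪β, y⟫ <;> by_cases b : ⟪β, x2⟫ ≤ ⟪β, y⟫ <;> simp [a, b]
  rw [e, h, angK]
  ring

lemma abs_le_one_of {a : ℝ} (h0 : 0 ≤ a) (h1 : a ≤ 1) : |a| ≤ 1 := by rwa [abs_of_nonneg h0]

lemma mul_mem01 {a b : ℝ} (h0 : 0 ≤ a) (h1 : a ≤ 1) (g0 : 0 ≤ b) (g1 : b ≤ 1) : |a * b| ≤ 1 :=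
  abs_le_one_of (mul_nonneg h0 g0) (mul_le_one₀ h1 g0 g1)

/-- generic swap: integrate a bounded function against a probability measure -/
lemma swap_half {P : Measure (EuclideanSpace ℝ (Fin d))} [IsProbabilityMeasure P] (g : (EuclideanSpace ℝ (Fin d)) → (EuclideanSpace ℝ (Fin d)) → ℝ)
    (hg : Measurable (fun p : (EuclideanSpace ℝ (Fin d)) × (EuclideanSpace ℝ (Fin d)) => g p.1 p.2)) (hb : ∀ x β, |g x β| ≤ 1) :
    ∫ x, (1 / 2 - ∫ β, g x β ∂(sphereUniform d)) ∂P =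
      1 / 2 - ∫ β, ∫ x, g x β ∂P ∂(sphereUniform d) := by
  have hi : Integrable (fun p : (EuclideanSpace ℝ (Fin d)) × (EuclideanSpace ℝ (Fin d)) => g p.1 p.2) (P.prod (sphereUniform d)) :=
    integrable_bdd hg 1 (fun p => hb _ _)
  rw [integral_sub (integrable_const _) hi.integral_prod_left, integral_integral_swap hi]
  simp

lemma inner_ang (P : Measure (EuclideanSpace ℝ (Fin d))) [IsProbabilityMeasure P] (hP : NAP P) (x1 y : (EuclideanSpace ℝ (Fin d))) (h : x1 ≠ y) :
    ∫ x2, angK x1 x2 y ∂P = 1 / 2 - ∫ β, kB β x1 y * cdfB P β y ∂(sphereUniform d) := by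
  have : ∫ x2, angK x1 x2 y ∂P =
      ∫ x2, (1 / 2 - ∫ β, kB β x1 y * kB β x2 y ∂(sphereUniform d)) ∂P := by
    apply integral_congr_ae
    filter_upwards [hP.ae_ne y] with x2 hx2
    exact angK_eq x1 x2 y h hx2
  rw [this, swap_half (fun x2 β => kB β x1 y * kB β x2 y)]
  · simp_rw [integral_const_mul, cdfB_eq]
  · exact (measurable_kB measurable_snd measurable_const measurable_const).mul
      (measurable_kB measurable_snd measurable_fst measurable_const)
  · exact fun x β => mul_mem01 (kB_nonneg _ _ _) (kB_le_one _ _ _) (kB_nonneg _ _ _) (kB_le_one _ _ _)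

/-- first projections of the angle kernel -/
def a1 (P Q : Measure (EuclideanSpace ℝ (Fin d))) (x : (EuclideanSpace ℝ (Fin d))) : ℝ := ∫ y, ∫ x2, angK x x2 y ∂P ∂Q
def a3 (P : Measure (EuclideanSpace ℝ (Fin d))) (y : (EuclideanSpace ℝ (Fin d))) : ℝ := ∫ x1, ∫ x2, angK x1 x2 y ∂P ∂P
def a0 (P Q : Measure (EuclideanSpace ℝ (Fin d))) : ℝ := ∫ y, a3 P y ∂Q

lemma a1_eq (P Q : Measure (EuclideanSpace ℝ (Fin d))) [IsProbabilityMeasure P] [IsProbabilityMeasure Q]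
    (hP : NAP P) (hQ : NAP Q) (x : (EuclideanSpace ℝ (Fin d))) :
    a1 P Q x = 1 / 2 - ∫ β, ∫ y, kB β x y * cdfB P β y ∂Q ∂(sphereUniform d) := by
  have : a1 P Q x = ∫ y, (1 / 2 - ∫ β, kB β x y * cdfB P β y ∂(sphereUniform d)) ∂Q := by
    apply integral_congr_ae
    filter_upwards [hQ.ae_ne x] with y hy
    exact inner_ang P hP x y hy.symm
  rw [this, swap_half (fun y β => kB β x y * cdfB P β y)]
  · exact (measurable_kB measurable_snd measurable_const measurable_fst).mul
      (measurable_cdfB' P measurable_snd measurable_fst)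
  · exact fun x β => mul_mem01 (kB_nonneg _ _ _) (kB_le_one _ _ _) (cdfB_nonneg _ _ _)
      (cdfB_le_one _ _ _)

lemma a3_eq (P : Measure (EuclideanSpace ℝ (Fin d))) [IsProbabilityMeasure P] (hP : NAP P) (y : (EuclideanSpace ℝ (Fin d))) :
    a3 P y = 1 / 2 - ∫ β, cdfB P β y ^ 2 ∂(sphereUniform d) := by
  have : a3 P y = ∫ x, (1 / 2 - ∫ β, kB β x y * cdfB P β y ∂(sphereUniform d)) ∂P := by
    apply integral_congr_ae
    filter_upwards [hP.ae_ne y] with x hx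
    exact inner_ang P hP x y hx
  rw [this, swap_half (fun x β => kB β x y * cdfB P β y)]
  · simp_rw [integral_mul_const, ← cdfB_eq, ← sq]
  · exact (measurable_kB measurable_snd measurable_fst measurable_const).mul
      (measurable_cdfB' P measurable_snd measurable_const)
  · exact fun x β => mul_mem01 (kB_nonneg _ _ _) (kB_le_one _ _ _) (cdfB_nonneg _ _ _)
      (cdfB_le_one _ _ _)

lemma a0_eq (P Q : Measure (EuclideanSpace ℝ (Fin d))) [IsProbabilityMeasure P] [IsProbabilityMeasure Q] (hP : NAP P) :
    a0 P Q = 1 / 2 - ∫ β, ∫ y, cdfB P β y ^ 2 ∂Q ∂(sphereUniform d) := by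
  have : a0 P Q = ∫ y, (1 / 2 - ∫ β, cdfB P β y ^ 2 ∂(sphereUniform d)) ∂Q := by
    unfold a0; simp_rw [a3_eq P hP]
  rw [this, swap_half (fun y β => cdfB P β y ^ 2)]
  · exact (measurable_cdfB' P measurable_snd measurable_fst).pow_const 2
  · intro x β
    simp only [sq]
    exact mul_mem01 (cdfB_nonneg _ _ _) (cdfB_le_one _ _ _) (cdfB_nonneg _ _ _) (cdfB_le_one _ _ _)

lemma integrable_cdfsq (P Q : Measure (EuclideanSpace ℝ (Fin d))) [IsProbabilityMeasure P] [IsProbabilityMeasure Q] :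
    Integrable (fun β => ∫ y, cdfB P β y ^ 2 ∂Q) (sphereUniform d) := by
  have hi : Integrable (fun p : (EuclideanSpace ℝ (Fin d)) × (EuclideanSpace ℝ (Fin d)) => cdfB P p.1 p.2 ^ 2) ((sphereUniform d).prod Q) :=
    integrable_bdd ((measurable_cdfB P).pow_const 2) 1 (fun p => by
      rw [sq]
      exact mul_mem01 (cdfB_nonneg _ _ _) (cdfB_le_one _ _ _) (cdfB_nonneg _ _ _) (cdfB_le_one _ _ _))
  exact hi.integral_prod_left

lemma cvmSq_eq (P Q : Measure (EuclideanSpace ℝ (Fin d))) [IsProbabilityMeasure P] [IsProbabilityMeasure Q]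
    (hP : NAP P) (hQ : NAP Q) (ϑ : ℝ) (h : ϑ ∈ Set.Ioo (0 : ℝ) 1) :
    cvmSq ϑ P Q = 1 / 3 - a0 P Q - a0 Q P := by
  have : cvmSq ϑ P Q = ∫ β, (∫ y, cdfB P β y ^ 2 ∂Q + ∫ y, cdfB Q β y ^ 2 ∂P - 2 / 3)
      ∂(sphereUniform d) := by
    apply integral_congr_ae
    filter_upwards [hP, hQ] with β h1 h2
    exact fcdf_diff_mix P Q (measurable_inner_left β) h1 h2 ϑ h
  have hadd : Integrable (fun β => ∫ y, cdfB P β y ^ 2 ∂Q + ∫ y, cdfB Q β y ^ 2 ∂P)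
    (sphereUniform d) := (integrable_cdfsq P Q).add (integrable_cdfsq Q P)
  rw [this, integral_sub hadd (integrable_const _),
    integral_add (integrable_cdfsq P Q) (integrable_cdfsq Q P), a0_eq P Q hP, a0_eq Q P hQ]
  simp
  ring

lemma cvmSq_eq' (P Q : Measure (EuclideanSpace ℝ (Fin d))) [IsProbabilityMeasure P] [IsProbabilityMeasure Q]
    (hP : NAP P) (hQ : NAP Q) :
    ∫ β, ∫ y, (cdfB P β y - cdfB Q β y) ^ 2 ∂Q ∂(sphereUniform d) = 1 / 3 - a0 P Q - a0 Q P := by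
  have : ∫ β, ∫ y, (cdfB P β y - cdfB Q β y) ^ 2 ∂Q ∂(sphereUniform d)
      = ∫ β, (∫ y, cdfB P β y ^ 2 ∂Q + ∫ y, cdfB Q β y ^ 2 ∂P - 2 / 3)
      ∂(sphereUniform d) := by
    apply integral_congr_ae
    filter_upwards [hP, hQ] with β h1 h2
    exact fcdf_diff_right P Q (measurable_inner_left β) h2
  have hadd : Integrable (fun β => ∫ y, cdfB P β y ^ 2 ∂Q + ∫ y, cdfB Q β y ^ 2 ∂P)
    (sphereUniform d) := (integrable_cdfsq P Q).add (integrable_cdfsq Q P)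
  rw [this, integral_sub hadd (integrable_const _),
    integral_add (integrable_cdfsq P Q) (integrable_cdfsq Q P), a0_eq P Q hP, a0_eq Q P hQ]
  simp
  ring

lemma abs_sub_le_one' {a b : ℝ} (h0 : 0 ≤ a) (h1 : a ≤ 1) (g0 : 0 ≤ b) (g1 : b ≤ 1) :
    |a - b| ≤ 1 := by rw [abs_le]; constructor <;> linarith

lemma proj_bound (P Q : Measure (EuclideanSpace ℝ (Fin d))) [IsProbabilityMeasure P] [IsProbabilityMeasure Q]
    (hP : NAP P) (hQ : NAP Q) (x : (EuclideanSpace ℝ (Fin d))) :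
    (2 * a1 P Q x + a3 Q x - 1 / 2) ^ 2 ≤ 4 * (1 / 3 - a0 P Q - a0 Q P) := by
  set g : (EuclideanSpace ℝ (Fin d)) → (EuclideanSpace ℝ (Fin d)) → ℝ := fun β y => kB β x y * (cdfB P β y - cdfB Q β y) with hg
  have hgm : Measurable (fun p : (EuclideanSpace ℝ (Fin d)) × (EuclideanSpace ℝ (Fin d)) => g p.1 p.2) :=
    (measurable_kB measurable_fst measurable_const measurable_snd).mul
      ((measurable_cdfB P).sub (measurable_cdfB Q))
  have hgb : ∀ β y, |g β y| ≤ 1 := fun β y => by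
    rw [hg, abs_mul]
    exact mul_le_one₀ (abs_le_one_of (kB_nonneg _ _ _) (kB_le_one _ _ _)) (abs_nonneg _)
      (abs_sub_le_one' (cdfB_nonneg _ _ _) (cdfB_le_one _ _ _) (cdfB_nonneg _ _ _) (cdfB_le_one _ _ _))
  have hgi : Integrable (fun p : (EuclideanSpace ℝ (Fin d)) × (EuclideanSpace ℝ (Fin d)) => g p.1 p.2) ((sphereUniform d).prod Q) :=
    integrable_bdd hgm 1 (fun p => hgb _ _)
  have hg2i : Integrable (fun p : (EuclideanSpace ℝ (Fin d)) × (EuclideanSpace ℝ (Fin d)) => g p.1 p.2 ^ 2) ((sphereUniform d).prod Q) :=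
    integrable_bdd (hgm.pow_const 2) 1 (fun p => by
      rw [abs_pow]; exact pow_le_one₀ (abs_nonneg _) (hgb _ _))
  have hi1 : Integrable (fun p : (EuclideanSpace ℝ (Fin d)) × (EuclideanSpace ℝ (Fin d)) => kB p.1 x p.2 * cdfB P p.1 p.2) ((sphereUniform d).prod Q) :=
    integrable_bdd ((measurable_kB measurable_fst measurable_const measurable_snd).mul
      (measurable_cdfB P)) 1 (fun p => mul_mem01 (kB_nonneg _ _ _) (kB_le_one _ _ _)
        (cdfB_nonneg _ _ _) (cdfB_le_one _ _ _))
  have hi2 : Integrable (fun β => cdfB Q β x ^ 2) (sphereUniform d) :=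
    integrable_bdd ((measurable_cdfB' Q measurable_id measurable_const).pow_const 2) 1 (fun p => by
      rw [sq]
      exact mul_mem01 (cdfB_nonneg _ _ _) (cdfB_le_one _ _ _) (cdfB_nonneg _ _ _) (cdfB_le_one _ _ _))
  have key : 2 * a1 P Q x + a3 Q x - 1 / 2 = -2 * ∫ β, ∫ y, g β y ∂Q ∂(sphereUniform d) := by
    rw [a1_eq P Q hP hQ, a3_eq Q hQ]
    have e : (2 * ∫ β, ∫ y, kB β x y * cdfB P β y ∂Q ∂(sphereUniform d)) +
        ∫ β, cdfB Q β x ^ 2 ∂(sphereUniform d) =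
        2 * (∫ β, ∫ y, g β y ∂Q ∂(sphereUniform d)) + 1 := by
      rw [← integral_const_mul, ← integral_const_mul,
        ← integral_add (hi1.integral_prod_left.const_mul 2) hi2]
      have : (1 : ℝ) = ∫ β, (1:ℝ) ∂(sphereUniform d) := by simp
      rw [this, ← integral_add (hgi.integral_prod_left.const_mul 2) (integrable_const _)]
      apply integral_congr_ae
      filter_upwards [hQ, hi1.prod_right_ae] with β hβ hi
      have hst := fcdf_star Q (measurable_inner_left β) hβ ⟪β, x⟫
      change 2 * ∫ y, kB β x y * cdfB Q β y ∂Q = 1 - cdfB Q β x ^ 2 at hst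
      have hiQ : Integrable (fun y => kB β x y * cdfB Q β y) Q :=
        integrable_bdd ((measurable_kB measurable_const measurable_const measurable_id).mul
          (measurable_cdfB' Q measurable_const measurable_id)) 1
          (fun p => mul_mem01 (kB_nonneg _ _ _) (kB_le_one _ _ _)
          (cdfB_nonneg _ _ _) (cdfB_le_one _ _ _))
      have : ∫ y, g β y ∂Q = ∫ y, kB β x y * cdfB P β y ∂Q - ∫ y, kB β x y * cdfB Q β y ∂Q := by
        rw [← integral_sub hi hiQ]
        congr 1; ext y; simp only [hg]; ring
      rw [this]
      linarith
    linarith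
  rw [key, ← cvmSq_eq' P Q hP hQ, mul_pow]
  have h4 : ((-2 : ℝ)) ^ 2 = 4 := by norm_num
  rw [h4]
  refine mul_le_mul_of_nonneg_left ?_ (by norm_num)
  set h : (EuclideanSpace ℝ (Fin d)) → ℝ := fun β => ∫ y, g β y ∂Q with hh
  have hhm : Measurable h := hgm.stronglyMeasurable.integral_prod_right.measurable
  have hhb : ∀ β, |h β| ≤ 1 := fun β => by
    have := norm_integral_le_of_norm_le_const (μ := Q) (f := g β) (C := 1)
      (Filter.Eventually.of_forall (hgb β))
    simpa using this
  refine (sq_integral_le_bdd (integrable_bdd hhm 1 hhb) (integrable_bdd (hhm.pow_const 2) 1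
    (fun β => by rw [abs_pow]; exact pow_le_one₀ (abs_nonneg _) (hhb β)))).trans ?_
  have hdm : Measurable (fun p : (EuclideanSpace ℝ (Fin d)) × (EuclideanSpace ℝ (Fin d)) => (cdfB P p.1 p.2 - cdfB Q p.1 p.2) ^ 2) :=
    ((measurable_cdfB P).sub (measurable_cdfB Q)).pow_const 2
  have hdi : Integrable (fun p : (EuclideanSpace ℝ (Fin d)) × (EuclideanSpace ℝ (Fin d)) => (cdfB P p.1 p.2 - cdfB Q p.1 p.2) ^ 2)
      ((sphereUniform d).prod Q) :=
    integrable_bdd hdm 1 (fun p => by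
      rw [abs_pow]
      exact pow_le_one₀ (abs_nonneg _) (abs_sub_le_one' (cdfB_nonneg _ _ _) (cdfB_le_one _ _ _)
        (cdfB_nonneg _ _ _) (cdfB_le_one _ _ _)))
  refine integral_mono_ae (integrable_bdd (hhm.pow_const 2) 1
    (fun β => by rw [abs_pow]; exact pow_le_one₀ (abs_nonneg _) (hhb β))) hdi.integral_prod_left ?_
  filter_upwards [hgi.prod_right_ae, hg2i.prod_right_ae, hdi.prod_right_ae] with β b1 b2 b3
  refine (sq_integral_le_bdd b1 b2).trans ?_
  refine integral_mono b2 b3 (fun y => ?_)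
  simp only [hg, mul_pow]
  exact mul_le_of_le_one_left (sq_nonneg _) (pow_le_one₀ (kB_nonneg _ _ _) (kB_le_one _ _ _))
end

section Resample
variable {K E : Type*} [Fintype K] [DecidableEq K] [MeasurableSpace E]

lemma measurable_update_prod (a : K) :
    Measurable (fun p : E × (K → E) => Function.update p.2 a p.1) := by
  rw [measurable_pi_iff]
  intro i
  by_cases h : i = a
  · subst h; simpa using measurable_fst
  · simp only [Function.update_of_ne h]
    exact (measurable_pi_apply i).comp measurable_snd

lemma measurePreserving_update (μ : K → Measure E) [∀ i, IsProbabilityMeasure (μ i)] (a : K) :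
    MeasurePreserving (fun p : E × (K → E) => Function.update p.2 a p.1)
      ((μ a).prod (Measure.pi μ)) (Measure.pi μ) := by
  refine ⟨measurable_update_prod a, ?_⟩
  symm
  apply Measure.pi_eq
  intro s hs
  rw [Measure.map_apply (measurable_update_prod a) (MeasurableSet.univ_pi hs)]
  have : (fun p : E × (K → E) => Function.update p.2 a p.1) ⁻¹' (Set.univ.pi s) =
      (s a) ×ˢ (Set.univ.pi (Function.update s a Set.univ)) := by
    ext ⟨x, ω⟩
    simp only [Set.mem_preimage, Set.mem_pi, Set.mem_univ, forall_true_left, Set.mem_prod]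
    constructor
    · intro h
      refine ⟨by simpa using h a, fun i => ?_⟩
      by_cases hi : i = a
      · subst hi; simp
      · simpa [Function.update_of_ne hi] using h i
    · rintro ⟨h1, h2⟩ i
      by_cases hi : i = a
      · subst hi; simpa using h1
      · simpa [Function.update_of_ne hi] using h2 i
  rw [this, Measure.prod_prod, Measure.pi_pi]
  rw [← Finset.mul_prod_erase Finset.univ _ (Finset.mem_univ a),
    ← Finset.mul_prod_erase Finset.univ (fun i => (μ i) (s i)) (Finset.mem_univ a)]
  simp only [Function.update_self, measure_univ, one_mul]
  congr 1
  apply Finset.prod_congr rfl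
  intro i hi
  rw [Function.update_of_ne (Finset.ne_of_mem_erase hi)]

lemma resample (μ : K → Measure E) [∀ i, IsProbabilityMeasure (μ i)] (a : K) {F : (K → E) → ℝ}
    (hF : Measurable F) (C : ℝ) (hb : ∀ ω, |F ω| ≤ C) :
    ∫ ω, F ω ∂(Measure.pi μ) = ∫ ω, ∫ x, F (Function.update ω a x) ∂(μ a) ∂(Measure.pi μ) := by
  have hmp := measurePreserving_update μ a
  rw [← hmp.map_eq, integral_map hmp.measurable.aemeasurable hF.aestronglyMeasurable, hmp.map_eq,
    integral_prod_symm]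
  exact integrable_bdd (hF.comp hmp.measurable) C (fun _ => hb _)

lemma resample2 (μ : K → Measure E) [∀ i, IsProbabilityMeasure (μ i)] (a b : K) {F : (K → E) → ℝ}
    (hF : Measurable F) (C : ℝ) (hb : ∀ ω, |F ω| ≤ C) :
    ∫ ω, F ω ∂(Measure.pi μ) =
      ∫ ω, ∫ y, ∫ x, F (Function.update (Function.update ω b y) a x) ∂(μ a) ∂(μ b)
        ∂(Measure.pi μ) := by
  rw [resample μ a hF C hb]
  have hm : Measurable (fun ω => ∫ x, F (Function.update ω a x) ∂(μ a)) := by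
    have : StronglyMeasurable (fun p : (K → E) × E => F (Function.update p.1 a p.2)) :=
      (hF.comp ((measurable_update_prod a).comp measurable_swap)).stronglyMeasurable
    exact this.integral_prod_right.measurable
  rw [resample μ b hm C]
  intro ω
  have := norm_integral_le_of_norm_le_const (μ := μ a)
    (f := fun x => F (Function.update ω a x)) (C := C) (Filter.Eventually.of_forall fun x => hb _)
  simpa using this

end Resample

section UStat
variable {K E : Type*} [Fintype K] [DecidableEq K] [MeasurableSpace E]

/-- degenerate kernel assumptions -/
structure Degen (P Q : Measure E) (r : E → E → E → ℝ) (M : ℝ) : Prop where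
  meas : Measurable (fun p : E × E × E => r p.1 p.2.1 p.2.2)
  bdd : ∀ x y z, |r x y z| ≤ M
  symm : ∀ x y z, r x y z = r y x z
  d12 : ∀ z, ∫ y, ∫ x, r x y z ∂P ∂P = 0
  d13 : ∀ y, ∫ z, ∫ x, r x y z ∂P ∂Q = 0

lemma Degen.meas_comp {P Q : Measure E} {r : E → E → E → ℝ} {M : ℝ} (h : Degen P Q r M)
    (a b c : K) : Measurable (fun ω : K → E => r (ω a) (ω b) (ω c)) := by
  have h1 : Measurable (fun ω : K → E => (ω a, ω b, ω c)) := by fun_prop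
  have := h.meas.comp h1
  simpa only [Function.comp_def] using this

variable (μ : K → Measure E) [∀ i, IsProbabilityMeasure (μ i)]

lemma Degen.zero12 {P Q : Measure E} {r : E → E → E → ℝ} {M : ℝ} (h : Degen P Q r M)
    (a b c : K) (hab : a ≠ b) (hac : a ≠ c) (hbc : b ≠ c) (ha : μ a = P) (hb : μ b = P)
    (G : (K → E) → ℝ) (hG : Measurable G) (C : ℝ) (hGb : ∀ ω, |G ω| ≤ C)
    (hGi : ∀ ω y x, G (Function.update (Function.update ω b y) a x) = G ω) :
    ∫ ω, r (ω a) (ω b) (ω c) * G ω ∂(Measure.pi μ) = 0 := by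
  rw [resample2 μ a b (F := fun ω => r (ω a) (ω b) (ω c) * G ω) ((h.meas_comp a b c).mul hG) (M * C) (fun ω => by
    rw [abs_mul]
    exact mul_le_mul (h.bdd _ _ _) (hGb _) (abs_nonneg _) ((abs_nonneg _).trans (h.bdd (ω a) (ω a) (ω a))))]
  rw [ha, hb]
  simp only [hGi, Function.update_self, Function.update_of_ne hab.symm,
    Function.update_of_ne hac.symm, Function.update_of_ne hbc.symm, integral_mul_const, h.d12,
    zero_mul, integral_zero]

lemma Degen.zero13 {P Q : Measure E} {r : E → E → E → ℝ} {M : ℝ} (h : Degen P Q r M)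
    (a b c : K) (hab : a ≠ b) (hac : a ≠ c) (hbc : b ≠ c) (ha : μ a = P) (hc : μ c = Q)
    (G : (K → E) → ℝ) (hG : Measurable G) (C : ℝ) (hGb : ∀ ω, |G ω| ≤ C)
    (hGi : ∀ ω y x, G (Function.update (Function.update ω c y) a x) = G ω) :
    ∫ ω, r (ω a) (ω b) (ω c) * G ω ∂(Measure.pi μ) = 0 := by
  rw [resample2 μ a c (F := fun ω => r (ω a) (ω b) (ω c) * G ω) ((h.meas_comp a b c).mul hG) (M * C) (fun ω => by
    rw [abs_mul]
    exact mul_le_mul (h.bdd _ _ _) (hGb _) (abs_nonneg _) ((abs_nonneg _).trans (h.bdd (ω a) (ω a) (ω a))))]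
  rw [ha, hc]
  simp only [hGi, Function.update_self, Function.update_of_ne hab.symm,
    Function.update_of_ne hac.symm, Function.update_of_ne hbc, integral_mul_const, h.d13,
    zero_mul, integral_zero]

variable {m n : ℕ} (u : Fin m → K) (v : Fin n → K)

/-- summand of the degenerate U-statistic -/
def uterm (r : E → E → E → ℝ) (t : Fin m × Fin m × Fin n) (ω : K → E) : ℝ :=
  if t.1 ≠ t.2.1 then r (ω (u t.1)) (ω (u t.2.1)) (ω (v t.2.2)) else 0

/-- overlap count bound -/
def ocount (t t' : Fin m × Fin m × Fin n) : ℝ :=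
  (if t.1 = t'.1 then 1 else 0) * (if t.2.1 = t'.2.1 then 1 else 0) +
  (if t.1 = t'.2.1 then 1 else 0) * (if t.2.1 = t'.1 then 1 else 0) +
  (if t.2.2 = t'.2.2 then 1 else 0) * ((if t.1 = t'.1 then 1 else 0) +
    (if t.1 = t'.2.1 then 1 else 0) + (if t.2.1 = t'.1 then 1 else 0) +
    (if t.2.1 = t'.2.1 then 1 else 0))

lemma ocount_sum : ∑ t : Fin m × Fin m × Fin n, ∑ t' : Fin m × Fin m × Fin n, ocount t t' =
    2 * (m : ℝ) ^ 2 * n ^ 2 + 4 * m ^ 3 * n := by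
  simp only [ocount, Fintype.sum_prod_type, Finset.sum_add_distrib, mul_add,
    mul_ite, mul_one, mul_zero, Finset.sum_ite_eq, Finset.sum_ite_eq', Finset.sum_const,
    Finset.mem_univ, if_true, Finset.card_univ, Fintype.card_fin, nsmul_eq_mul, smul_zero]
  simp [Finset.sum_ite_eq, apply_ite Finset.card, Nat.cast_ite]
  ring

lemma uterm_meas {P Q : Measure E} {r : E → E → E → ℝ} {M : ℝ} (h : Degen P Q r M)
    (t : Fin m × Fin m × Fin n) : Measurable (uterm u v r t) := by
  unfold uterm
  split_ifs
  · exact h.meas_comp _ _ _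
  · exact measurable_const

lemma uterm_bdd {P Q : Measure E} {r : E → E → E → ℝ} {M : ℝ} (h : Degen P Q r M)
    (t : Fin m × Fin m × Fin n) (ω : K → E) : |uterm u v r t ω| ≤ M := by
  unfold uterm
  split_ifs
  · exact h.bdd _ _ _
  · simpa using (abs_nonneg _).trans (h.bdd (ω (u t.1)) (ω (u t.1)) (ω (u t.1)))

lemma uterm_mean {P Q : Measure E} {r : E → E → E → ℝ} {M : ℝ} (h : Degen P Q r M)
    (hu : Function.Injective u) (huv : ∀ i j, u i ≠ v j)
    (hP : ∀ i, μ (u i) = P) (t : Fin m × Fin m × Fin n) :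
    ∫ ω, uterm u v r t ω ∂(Measure.pi μ) = 0 := by
  obtain ⟨i1, i2, j⟩ := t
  simp only [uterm]
  split_ifs with hne
  · have := h.zero12 μ (u i1) (u i2) (v j) (hu.ne hne) (huv _ _) (huv _ _) (hP _) (hP _)
      (fun _ => 1) measurable_const 1 (by simp) (by simp)
    simpa using this
  · simp

lemma uterm_cov {P Q : Measure E} {r : E → E → E → ℝ} {M : ℝ} (h : Degen P Q r M)
    (hu : Function.Injective u) (hv : Function.Injective v) (huv : ∀ i j, u i ≠ v j)
    (hP : ∀ i, μ (u i) = P) (hQ : ∀ j, μ (v j) = Q) (t t' : Fin m × Fin m × Fin n) :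
    ∫ ω, uterm u v r t ω * uterm u v r t' ω ∂(Measure.pi μ) ≤ M ^ 2 * ocount t t' := by
  have hM0 : 0 ≤ ocount t t' := by unfold ocount; positivity
  have hR : 0 ≤ M ^ 2 * ocount t t' := mul_nonneg (sq_nonneg _) hM0
  by_cases hone : 1 ≤ ocount t t'
  · have hle : ∀ ω, uterm u v r t ω * uterm u v r t' ω ≤ M ^ 2 := by
      intro ω
      have h1 := uterm_bdd u v h t ω
      have h2 := uterm_bdd u v h t' ω
      refine (le_abs_self _).trans ?_
      rw [abs_mul, sq]
      exact mul_le_mul h1 h2 (abs_nonneg _) ((abs_nonneg _).trans h1)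
    have hi : Integrable (fun ω => uterm u v r t ω * uterm u v r t' ω) (Measure.pi μ) :=
      integrable_bdd ((uterm_meas u v h t).mul (uterm_meas u v h t')) (M * M) (fun ω => by
        rw [abs_mul]
        exact mul_le_mul (uterm_bdd u v h t ω) (uterm_bdd u v h t' ω) (abs_nonneg _)
          ((abs_nonneg _).trans (uterm_bdd u v h t ω)))
    calc _ ≤ ∫ ω, M ^ 2 ∂(Measure.pi μ) := integral_mono hi (integrable_const _) hle
      _ = M ^ 2 := by simp
      _ ≤ _ := le_mul_of_one_le_right (sq_nonneg _) hone
  · refine le_of_eq_of_le ?_ hR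
    have hcase : (t.1 ≠ t'.1 ∧ t.1 ≠ t'.2.1 ∧ t.2.1 ≠ t'.1 ∧ t.2.1 ≠ t'.2.1) ∨
        (t.1 ≠ t'.1 ∧ t.1 ≠ t'.2.1 ∧ t.2.2 ≠ t'.2.2) ∨
        (t.2.1 ≠ t'.1 ∧ t.2.1 ≠ t'.2.1 ∧ t.2.2 ≠ t'.2.2) ∨ t.1 = t.2.1 ∨ t'.1 = t'.2.1 := by
      by_contra hcon
      apply hone
      unfold ocount
      split_ifs <;> first
          | (norm_num; done)
          | (exfalso; apply hcon; grind)
    have hG := uterm_meas u v h t'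
    obtain ⟨i1, i2, j⟩ := t
    obtain ⟨i1', i2', j'⟩ := t'
    simp only at hcase
    have hfin : i1 ≠ i2 → 
        ∫ ω, r (ω (u i1)) (ω (u i2)) (ω (v j)) * uterm u v r (i1', i2', j') ω ∂(Measure.pi μ) = 0 := by
      intro hne
      rcases hcase with ⟨c1, c2, c3, c4⟩ | ⟨c1, c2, c3⟩ | ⟨c1, c2, c3⟩ | c | c
      · refine h.zero12 μ _ _ _ (hu.ne hne) (huv _ _) (huv _ _) (hP _) (hP _) _ hG M
          (uterm_bdd u v h _) (fun ω y x => ?_)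
        simp only [uterm, Function.update_of_ne (hu.ne c1.symm), Function.update_of_ne (hu.ne c2.symm),
          Function.update_of_ne (hu.ne c3.symm), Function.update_of_ne (hu.ne c4.symm),
          Function.update_of_ne (huv _ _).symm]
      · refine h.zero13 μ _ _ _ (hu.ne hne) (huv _ _) (huv _ _) (hP _) (hQ _) _ hG M
          (uterm_bdd u v h _) (fun ω y x => ?_)
        simp only [uterm, Function.update_of_ne (hu.ne c1.symm), Function.update_of_ne (hu.ne c2.symm),
          Function.update_of_ne (hv.ne c3.symm), Function.update_of_ne (huv _ _),
          Function.update_of_ne (huv _ _).symm]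
      · have := h.zero13 μ (u i2) (u i1) (v j) (hu.ne hne.symm) (huv _ _) (huv _ _) (hP _) (hQ _) _ hG M
          (uterm_bdd u v h _) (fun ω y x => by
            simp only [uterm, Function.update_of_ne (hu.ne c1.symm), Function.update_of_ne (hu.ne c2.symm),
          Function.update_of_ne (hv.ne c3.symm), Function.update_of_ne (huv _ _),
          Function.update_of_ne (huv _ _).symm])
        rw [← this]
        congr 1; ext ω; rw [h.symm (ω (u i1))]
      · exact absurd c hne
      · simp [uterm, c]
    by_cases hne : i1 ≠ i2
    · rw [← hfin hne]
      simp [uterm, hne]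
    · simp [uterm, hne]

lemma ustat_var {P Q : Measure E} {r : E → E → E → ℝ} {M : ℝ} (h : Degen P Q r M)
    (hu : Function.Injective u) (hv : Function.Injective v) (huv : ∀ i j, u i ≠ v j)
    (hP : ∀ i, μ (u i) = P) (hQ : ∀ j, μ (v j) = Q) :
    ∫ ω, (∑ t, uterm u v r t ω) ^ 2 ∂(Measure.pi μ)
      ≤ M ^ 2 * (2 * (m : ℝ) ^ 2 * n ^ 2 + 4 * m ^ 3 * n) := by
  have hi : ∀ t t', Integrable (fun ω => uterm u v r t ω * uterm u v r t' ω) (Measure.pi μ) :=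
    fun t t' => integrable_bdd ((uterm_meas u v h t).mul (uterm_meas u v h t')) (M * M) (fun ω => by
        rw [abs_mul]
        exact mul_le_mul (uterm_bdd u v h t ω) (uterm_bdd u v h t' ω) (abs_nonneg _)
          ((abs_nonneg _).trans (uterm_bdd u v h t ω)))
  simp_rw [sq, Finset.sum_mul_sum]
  rw [integral_finsetSum _ (fun t _ => integrable_finsetSum _ fun t' _ => hi t t')]
  simp_rw [integral_finsetSum _ (fun t' _ => hi _ t')]
  have h2 := ocount_sum (m := m) (n := n)
  simp only [sq] at h2
  rw [← h2, Finset.mul_sum]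
  refine Finset.sum_le_sum fun t _ => ?_
  rw [Finset.mul_sum]
  refine Finset.sum_le_sum fun t' _ => ?_
  rw [← sq]
  exact uterm_cov μ u v h hu hv huv hP hQ t t'

lemma lin_var {P : Measure E} (hu : Function.Injective u) (hP : ∀ i, μ (u i) = P)
    {g : E → ℝ} (hg : Measurable g) (hg0 : ∫ x, g x ∂P = 0) (c : ℝ) (hc : ∀ x, g x ^ 2 ≤ c) :
    ∫ ω, (∑ i, g (ω (u i))) ^ 2 ∂(Measure.pi μ) ≤ m * c := by
  have hgb : ∀ x, |g x| ≤ √c := fun x => Real.abs_le_sqrt (hc x)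
  have hgm : ∀ i, Measurable (fun ω : K → E => g (ω (u i))) := fun i => hg.comp (measurable_pi_apply _)
  have hi : ∀ i j, Integrable (fun ω => g (ω (u i)) * g (ω (u j))) (Measure.pi μ) :=
    fun i j => integrable_bdd ((hgm i).mul (hgm j)) (√c * √c) (fun ω => by
        rw [abs_mul]
        exact mul_le_mul (hgb _) (hgb _) (abs_nonneg _) (sqrt_nonneg _))
  have hcov : ∀ i j, ∫ ω, g (ω (u i)) * g (ω (u j)) ∂(Measure.pi μ) ≤ if i = j then c else 0 := by
    intro i j
    split_ifs with hij
    · subst hij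
      calc _ ≤ ∫ ω, c ∂(Measure.pi μ) := integral_mono (hi i i) (integrable_const _) (fun ω => by
            simp only [← sq]; exact hc _)
        _ = c := by simp
    · apply le_of_eq
      rw [resample μ (u i) (F := fun ω => g (ω (u i)) * g (ω (u j))) ((hgm i).mul (hgm j)) (√c * √c) (fun ω => by
        rw [abs_mul]
        exact mul_le_mul (hgb _) (hgb _) (abs_nonneg _) (sqrt_nonneg _))]
      have : u j ≠ u i := hu.ne (Ne.symm hij)
      rw [hP]
      simp [Function.update_of_ne this, integral_mul_const, hg0]
  simp_rw [sq, Finset.sum_mul_sum]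
  rw [integral_finsetSum _ (fun t _ => integrable_finsetSum _ fun t' _ => hi t t')]
  simp_rw [integral_finsetSum _ (fun t' _ => hi _ t')]
  calc _ ≤ ∑ i : Fin m, ∑ j : Fin m, (if i = j then c else 0) :=
        Finset.sum_le_sum fun i _ => Finset.sum_le_sum fun j _ => hcov i j
    _ = _ := by simp

lemma lin_mean {P : Measure E} (hP : ∀ i, μ (u i) = P)
    {g : E → ℝ} (hg : Measurable g) (hg0 : ∫ x, g x ∂P = 0) (i : Fin m) :
    ∫ ω, g (ω (u i)) ∂(Measure.pi μ) = 0 := by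
  have := (measurePreserving_eval μ (u i))
  have h2 := integral_map (μ := Measure.pi μ) this.measurable.aemeasurable
    (f := g) hg.aestronglyMeasurable
  rw [this.map_eq, hP i, hg0] at h2
  simpa using h2.symm
end UStat

section SumAlg

lemma ind_sum {m : ℕ} (i : Fin m) : ∑ j : Fin m, (if i ≠ j then (1 : ℝ) else 0) = (m : ℝ) - 1 := by
  have : ∀ j, (if i ≠ j then (1 : ℝ) else 0) = 1 - if i = j then 1 else 0 := by
    intro j; by_cases h : i = j <;> simp [h]
  simp [this]

lemma ind_sum' {m : ℕ} (i : Fin m) : ∑ j : Fin m, (if j ≠ i then (1 : ℝ) else 0) = (m : ℝ) - 1 := by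
  rw [← ind_sum i]; simp only [ne_comm]

lemma sum_alg1 {m n : ℕ} (hm : 3 ≤ m) (hn : 3 ≤ n) (A : Fin m → Fin m → Fin n → ℝ)
    (B : Fin n → Fin n → Fin m → ℝ) :
    ((m : ℝ) * ((m : ℝ) - 1) * ((n : ℝ) * ((n : ℝ) - 1)))⁻¹ *
    (∑ i1 : Fin m, ∑ i2 : Fin m, ∑ j1 : Fin n, ∑ j2 : Fin n,
      if i1 ≠ i2 ∧ j1 ≠ j2 then (1 / 3 - A i1 i2 j1 - B j1 j2 i1) else 0) =
    1 / 3 - ((m : ℝ) * (m - 1) * n)⁻¹ *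
        (∑ t : Fin m × Fin m × Fin n, if t.1 ≠ t.2.1 then A t.1 t.2.1 t.2.2 else 0)
      - ((n : ℝ) * (n - 1) * m)⁻¹ *
        (∑ t : Fin n × Fin n × Fin m, if t.1 ≠ t.2.1 then B t.1 t.2.1 t.2.2 else 0) := by
  have hm' : (3 : ℝ) ≤ m := by exact_mod_cast hm
  have hn' : (3 : ℝ) ≤ n := by exact_mod_cast hn
  have e : ∀ i1 i2 j1 j2, (if i1 ≠ i2 ∧ j1 ≠ j2 then (1 / 3 - A i1 i2 j1 - B j1 j2 i1) else 0) =
      1 / 3 * (if i1 ≠ i2 then 1 else 0) * (if j1 ≠ j2 then 1 else 0)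
      - (if i1 ≠ i2 then A i1 i2 j1 else 0) * (if j1 ≠ j2 then 1 else 0)
      - (if j1 ≠ j2 then B j1 j2 i1 else 0) * (if i1 ≠ i2 then 1 else 0) := by
    intro i1 i2 j1 j2
    by_cases h1 : i1 = i2 <;> by_cases h2 : j1 = j2 <;> simp [h1, h2]
  have e1 : ∑ i1 : Fin m, ∑ i2 : Fin m, ∑ j1 : Fin n, ∑ j2 : Fin n,
      1 / 3 * (if i1 ≠ i2 then (1 : ℝ) else 0) * (if j1 ≠ j2 then 1 else 0)
      = 1 / 3 * ((m : ℝ) * (m - 1) * (n * (n - 1))) := by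
    simp_rw [← Finset.mul_sum, ind_sum, ← Finset.sum_mul, ← Finset.mul_sum, ind_sum]
    simp only [Finset.sum_const, Finset.card_univ, Fintype.card_fin, nsmul_eq_mul]
    ring
  have e2 : ∑ i1 : Fin m, ∑ i2 : Fin m, ∑ j1 : Fin n, ∑ j2 : Fin n,
      (if i1 ≠ i2 then A i1 i2 j1 else 0) * (if j1 ≠ j2 then (1 : ℝ) else 0)
      = (n - 1) * ∑ t : Fin m × Fin m × Fin n, if t.1 ≠ t.2.1 then A t.1 t.2.1 t.2.2 else 0 := by
    simp_rw [← Finset.mul_sum, ind_sum, ← Finset.sum_mul, Fintype.sum_prod_type]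
    ring
  have e3 : ∑ i1 : Fin m, ∑ i2 : Fin m, ∑ j1 : Fin n, ∑ j2 : Fin n,
      (if j1 ≠ j2 then B j1 j2 i1 else 0) * (if i1 ≠ i2 then (1 : ℝ) else 0)
      = (m - 1) * ∑ t : Fin n × Fin n × Fin m, if t.1 ≠ t.2.1 then B t.1 t.2.1 t.2.2 else 0 := by
    simp_rw [← Finset.sum_mul, ← Finset.mul_sum, ind_sum, ← Finset.sum_mul, Fintype.sum_prod_type]
    rw [mul_comm]
    congr 1
    rw [Finset.sum_comm]
    refine Finset.sum_congr rfl fun j1 _ => ?_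
    rw [Finset.sum_comm]
  simp_rw [e, Finset.sum_sub_distrib]
  rw [e1, e2, e3]
  have h1 : (m : ℝ) ≠ 0 := by linarith
  have h2 : (n : ℝ) ≠ 0 := by linarith
  have h3 : (m : ℝ) - 1 ≠ 0 := by linarith
  have h4 : (n : ℝ) - 1 ≠ 0 := by linarith
  field_simp

lemma sum_alg2 {m n : ℕ} (hm : 3 ≤ m) (hn : 3 ≤ n) (A R : Fin m → Fin m → Fin n → ℝ)
    (f : Fin m → ℝ) (h : Fin n → ℝ) (c : ℝ) (hA : ∀ i1 i2 j, R i1 i2 j = A i1 i2 j - f i1 - f i2 - h j + 2 * c) :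
    ((m : ℝ) * (m - 1) * n)⁻¹ *
        (∑ t : Fin m × Fin m × Fin n, if t.1 ≠ t.2.1 then A t.1 t.2.1 t.2.2 else 0) =
    ((m : ℝ) * (m - 1) * n)⁻¹ *
        (∑ t : Fin m × Fin m × Fin n, if t.1 ≠ t.2.1 then R t.1 t.2.1 t.2.2 else 0)
      + 2 * ((m : ℝ)⁻¹ * ∑ i, f i) + (n : ℝ)⁻¹ * ∑ j, h j - 2 * c := by
  have hm' : (3 : ℝ) ≤ m := by exact_mod_cast hm
  have hn' : (3 : ℝ) ≤ n := by exact_mod_cast hn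
  have e : ∀ i1 i2 j, (if i1 ≠ i2 then A i1 i2 j else 0) = (if i1 ≠ i2 then R i1 i2 j else 0)
      + f i1 * (if i1 ≠ i2 then 1 else 0) + f i2 * (if i1 ≠ i2 then 1 else 0)
      + (if i1 ≠ i2 then 1 else 0) * h j - 2 * c * (if i1 ≠ i2 then 1 else 0) := by
    intro i1 i2 j
    by_cases h1 : i1 = i2
    · simp [h1]
    · simp only [ne_eq, h1, not_false_eq_true, if_true, hA]; ring
  have e1 : ∑ i1 : Fin m, ∑ i2 : Fin m, ∑ j : Fin n, f i1 * (if i1 ≠ i2 then (1 : ℝ) else 0)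
      = (m - 1) * n * ∑ i, f i := by
    simp only [Finset.sum_const, Finset.card_univ, Fintype.card_fin, nsmul_eq_mul]
    simp_rw [← Finset.mul_sum, ind_sum, ← Finset.sum_mul]
    ring
  have e2 : ∑ i1 : Fin m, ∑ i2 : Fin m, ∑ j : Fin n, f i2 * (if i1 ≠ i2 then (1 : ℝ) else 0)
      = (m - 1) * n * ∑ i, f i := by
    rw [Finset.sum_comm]
    simp only [Finset.sum_const, Finset.card_univ, Fintype.card_fin, nsmul_eq_mul]
    simp_rw [← Finset.mul_sum, ind_sum', ← Finset.sum_mul]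
    ring
  have e3 : ∑ i1 : Fin m, ∑ i2 : Fin m, ∑ j : Fin n, (if i1 ≠ i2 then (1 : ℝ) else 0) * h j
      = m * (m - 1) * ∑ j, h j := by
    simp_rw [← Finset.mul_sum, ← Finset.sum_mul, ind_sum]
    simp only [Finset.sum_const, Finset.card_univ, Fintype.card_fin, nsmul_eq_mul]
  have e4 : ∑ i1 : Fin m, ∑ i2 : Fin m, ∑ j : Fin n, 2 * c * (if i1 ≠ i2 then (1 : ℝ) else 0)
      = 2 * c * (m * (m - 1) * n) := by
    simp only [Finset.sum_const, Finset.card_univ, Fintype.card_fin, nsmul_eq_mul]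
    simp_rw [← Finset.mul_sum, ind_sum]
    simp only [Finset.sum_const, Finset.card_univ, Fintype.card_fin, nsmul_eq_mul]
    ring
  simp_rw [Fintype.sum_prod_type, e, Finset.sum_sub_distrib, Finset.sum_add_distrib]
  rw [e1, e2, e3, e4]
  have h1 : (m : ℝ) ≠ 0 := by linarith
  have h2 : (n : ℝ) ≠ 0 := by linarith
  have h3 : (m : ℝ) - 1 ≠ 0 := by linarith
  field_simp
  ring

end SumAlg

section Hoeff
variable {d : ℕ}

lemma int01 {α : Type*} [MeasurableSpace α] (μ : Measure α) [IsProbabilityMeasure μ] {f : α → ℝ}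
    (h0 : ∀ x, 0 ≤ f x) (h1 : ∀ x, f x ≤ 1) : 0 ≤ ∫ x, f x ∂μ ∧ ∫ x, f x ∂μ ≤ 1 := by
  refine ⟨integral_nonneg h0, ?_⟩
  have := integral_mono_of_nonneg (μ := μ) (f := f) (g := fun _ => (1 : ℝ))
    (Filter.Eventually.of_forall h0) (integrable_const _) (Filter.Eventually.of_forall h1)
  simpa using this

/-- partial integral of the angle kernel -/
def b2 (P : Measure (EuclideanSpace ℝ (Fin d))) (x y : (EuclideanSpace ℝ (Fin d))) : ℝ := ∫ x2, angK x x2 y ∂P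

variable (P Q : Measure (EuclideanSpace ℝ (Fin d))) [IsProbabilityMeasure P] [IsProbabilityMeasure Q]

lemma b2_mem (x y : (EuclideanSpace ℝ (Fin d))) : 0 ≤ b2 P x y ∧ b2 P x y ≤ 1 :=
  int01 P (fun _ => angK_nonneg _ _ _) (fun _ => angK_le _ _ _)

lemma a1_mem (x : (EuclideanSpace ℝ (Fin d))) : 0 ≤ a1 P Q x ∧ a1 P Q x ≤ 1 :=
  int01 Q (fun y => (b2_mem P x y).1) (fun y => (b2_mem P x y).2)

lemma a3_mem (y : (EuclideanSpace ℝ (Fin d))) : 0 ≤ a3 P y ∧ a3 P y ≤ 1 :=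
  int01 P (fun x => (b2_mem P x y).1) (fun x => (b2_mem P x y).2)

lemma a0_mem : 0 ≤ a0 P Q ∧ a0 P Q ≤ 1 :=
  int01 Q (fun x => (a3_mem P x).1) (fun x => (a3_mem P x).2)

lemma measurable_b2 : Measurable (fun p : (EuclideanSpace ℝ (Fin d)) × (EuclideanSpace ℝ (Fin d)) => b2 P p.1 p.2) := by
  have h : Measurable (fun q : ((EuclideanSpace ℝ (Fin d)) × (EuclideanSpace ℝ (Fin d))) × (EuclideanSpace ℝ (Fin d)) => ((q.1.1, q.2, q.1.2) : (EuclideanSpace ℝ (Fin d)) × (EuclideanSpace ℝ (Fin d)) × (EuclideanSpace ℝ (Fin d)))) := by fun_prop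
  have h2 := measurable_angK.comp h
  have h3 : StronglyMeasurable (fun q : ((EuclideanSpace ℝ (Fin d)) × (EuclideanSpace ℝ (Fin d))) × (EuclideanSpace ℝ (Fin d)) => angK q.1.1 q.2 q.1.2) := by
    have := h2.stronglyMeasurable
    simpa only [Function.comp_def] using this
  exact h3.integral_prod_right.measurable

lemma measurable_a1 : Measurable (a1 P Q) :=
  (measurable_b2 P).stronglyMeasurable.integral_prod_right.measurable

lemma measurable_a3 : Measurable (a3 P) :=
  (measurable_b2 P).stronglyMeasurable.integral_prod_left.measurable

lemma measurable_b2_left (y : (EuclideanSpace ℝ (Fin d))) : Measurable (fun x => b2 P x y) := by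
  have h : Measurable (fun x : (EuclideanSpace ℝ (Fin d)) => ((x, y) : (EuclideanSpace ℝ (Fin d)) × (EuclideanSpace ℝ (Fin d)))) := by fun_prop
  have := (measurable_b2 P).comp h
  simpa only [Function.comp_def] using this

lemma measurable_b2_right (x : (EuclideanSpace ℝ (Fin d))) : Measurable (fun y => b2 P x y) := by
  have h : Measurable (fun y : (EuclideanSpace ℝ (Fin d)) => ((x, y) : (EuclideanSpace ℝ (Fin d)) × (EuclideanSpace ℝ (Fin d)))) := by fun_prop
  have := (measurable_b2 P).comp h
  simpa only [Function.comp_def] using this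

lemma int_a1 : ∫ x, a1 P Q x ∂P = a0 P Q := by
  have : Integrable (Function.uncurry (b2 P)) (P.prod Q) := by
    refine integrable_bdd (measurable_b2 P) 1 (fun p => abs_le_one_of (b2_mem P _ _).1 (b2_mem P _ _).2)
  exact integral_integral_swap this

lemma a1_int (R : Measure (EuclideanSpace ℝ (Fin d))) [IsProbabilityMeasure R] : Integrable (a1 P Q) R :=
  integrable_bdd (measurable_a1 P Q) 1 (fun p => abs_le_one_of (a1_mem P Q _).1 (a1_mem P Q _).2)

lemma a3_int (R : Measure (EuclideanSpace ℝ (Fin d))) [IsProbabilityMeasure R] : Integrable (a3 P) R :=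
  integrable_bdd (measurable_a3 P) 1 (fun p => abs_le_one_of (a3_mem P _).1 (a3_mem P _).2)

/-- degenerate part of the angle kernel -/
def rK (x1 x2 y : (EuclideanSpace ℝ (Fin d))) : ℝ := angK x1 x2 y - a1 P Q x1 - a1 P Q x2 - a3 P y + 2 * a0 P Q

lemma measurable_angK1 (y z : (EuclideanSpace ℝ (Fin d))) : Measurable (fun x => angK x y z) := by
  have h : Measurable (fun x : (EuclideanSpace ℝ (Fin d)) => ((x, y, z) : (EuclideanSpace ℝ (Fin d)) × (EuclideanSpace ℝ (Fin d)) × (EuclideanSpace ℝ (Fin d)))) := by fun_prop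
  have := measurable_angK.comp h
  simpa only [Function.comp_def] using this

lemma rK_int1 (y z : (EuclideanSpace ℝ (Fin d))) : ∫ x, rK P Q x y z ∂P =
    b2 P y z - a0 P Q - a1 P Q y - a3 P z + 2 * a0 P Q := by
  have h1 : Integrable (fun x => angK x y z) P :=
    integrable_bdd (measurable_angK1 y z) 1 (fun p => abs_le_one_of (angK_nonneg _ _ _) (angK_le _ _ _))
  have h2 := a1_int P Q P
  have e : ∫ x, angK x y z ∂P = b2 P y z := by
    unfold b2; congr 1; ext x; exact angK_symm _ _ _
  have h3 : Integrable (fun x => angK x y z - a1 P Q x) P := h1.sub h2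
  have : ∀ x, rK P Q x y z = (angK x y z - a1 P Q x) + (- a1 P Q y - a3 P z + 2 * a0 P Q) := by
    intro x; unfold rK; ring
  simp_rw [this]
  rw [integral_add h3 (integrable_const _), integral_sub h1 h2, e, int_a1]
  simp
  ring

lemma rK_degen : Degen P Q (rK P Q) 6 where
  meas := by
    have h1 : Measurable (fun p : (EuclideanSpace ℝ (Fin d)) × (EuclideanSpace ℝ (Fin d)) × (EuclideanSpace ℝ (Fin d)) => a1 P Q p.1) := (measurable_a1 P Q).comp measurable_fst
    have h2 : Measurable (fun p : (EuclideanSpace ℝ (Fin d)) × (EuclideanSpace ℝ (Fin d)) × (EuclideanSpace ℝ (Fin d)) => a1 P Q p.2.1) :=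
      (measurable_a1 P Q).comp (measurable_fst.comp measurable_snd)
    have h3 : Measurable (fun p : (EuclideanSpace ℝ (Fin d)) × (EuclideanSpace ℝ (Fin d)) × (EuclideanSpace ℝ (Fin d)) => a3 P p.2.2) :=
      (measurable_a3 P).comp (measurable_snd.comp measurable_snd)
    exact (((measurable_angK.sub h1).sub h2).sub h3).add measurable_const
  bdd x y z := by
    unfold rK
    have := a1_mem P Q x
    have := a1_mem P Q y
    have := a3_mem P z
    have := a0_mem P Q
    have := angK_nonneg x y z
    have := angK_le x y z
    rw [abs_le]; constructor <;> linarith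
  symm x y z := by unfold rK; rw [angK_symm]; ring
  d12 z := by
    simp_rw [rK_int1]
    have h1 : Integrable (fun y => b2 P y z) P :=
      integrable_bdd (measurable_b2_left P z) 1 (fun p => abs_le_one_of (b2_mem _ _ _).1 (b2_mem _ _ _).2)
    have h2 := a1_int P Q P
    have h3 : Integrable (fun x => b2 P x z - a1 P Q x) P := h1.sub h2
    have : ∀ x, b2 P x z - a0 P Q - a1 P Q x - a3 P z + 2 * a0 P Q
      = (b2 P x z - a1 P Q x) + (- a3 P z + a0 P Q) := by intro x; ring
    simp_rw [this]
    have e : ∫ x, b2 P x z ∂P = a3 P z := rfl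
    rw [integral_add h3 (integrable_const _), integral_sub h1 h2, int_a1, e]
    simp
  d13 y := by
    simp_rw [rK_int1]
    have h1 : Integrable (fun z => b2 P y z) Q :=
      integrable_bdd (measurable_b2_right P y) 1 (fun p => abs_le_one_of (b2_mem _ _ _).1 (b2_mem _ _ _).2)
    have h2 := a3_int P Q
    have h3 : Integrable (fun z => b2 P y z - a3 P z) Q := h1.sub h2
    have : ∀ z, b2 P y z - a0 P Q - a1 P Q y - a3 P z + 2 * a0 P Q
      = (b2 P y z - a3 P z) + (- a1 P Q y + a0 P Q) := by intro x; ring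
    simp_rw [this]
    have e : ∫ z, b2 P y z ∂Q = a1 P Q y := rfl
    have e' : ∫ z, a3 P z ∂Q = a0 P Q := rfl
    rw [integral_add h3 (integrable_const _), integral_sub h1 h2, e, e']
    simp

/-- linear Hoeffding projection -/
def gK (x : (EuclideanSpace ℝ (Fin d))) : ℝ := 2 * a1 P Q x + a3 Q x - 2 * a0 P Q - a0 Q P

lemma measurable_gK : Measurable (gK P Q) :=
  ((((measurable_a1 P Q).const_mul 2).add (measurable_a3 Q)).sub measurable_const).sub measurable_const

lemma gK_int0 : ∫ x, (2 * a1 P Q x + a3 Q x) ∂P = 2 * a0 P Q + a0 Q P := by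
  rw [integral_add ((a1_int P Q P).const_mul 2) (a3_int Q P), integral_const_mul, int_a1]
  rfl

lemma gK_int : ∫ x, gK P Q x ∂P = 0 := by
  have h : Integrable (fun x => 2 * a1 P Q x + a3 Q x) P :=
    ((a1_int P Q P).const_mul 2).add (a3_int Q P)
  have : ∀ x, gK P Q x = (2 * a1 P Q x + a3 Q x) - (2 * a0 P Q + a0 Q P) := by
    intro x; unfold gK; ring
  simp_rw [this]
  rw [integral_sub h (integrable_const _), gK_int0]
  simp

lemma gK_sq (hP : NAP P) (hQ : NAP Q) (x : (EuclideanSpace ℝ (Fin d))) :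
    gK P Q x ^ 2 ≤ 16 * (1 / 3 - a0 P Q - a0 Q P) := by
  set W := 1 / 3 - a0 P Q - a0 Q P with hW
  set f : (EuclideanSpace ℝ (Fin d)) → ℝ := fun x => 2 * a1 P Q x + a3 Q x - 1 / 2 with hf
  have hb : ∀ x, f x ^ 2 ≤ 4 * W := proj_bound P Q hP hQ
  have h : Integrable (fun x => 2 * a1 P Q x + a3 Q x) P :=
    ((a1_int P Q P).const_mul 2).add (a3_int Q P)
  have hfi : Integrable f P := h.sub (integrable_const _)
  have hfm : Measurable f := (((measurable_a1 P Q).const_mul 2).add (measurable_a3 Q)).sub measurable_const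
  have hf2 : Integrable (fun x => f x ^ 2) P := integrable_bdd (hfm.pow_const 2) (4 * W) (fun x => by
    rw [abs_of_nonneg (sq_nonneg _)]; exact hb x)
  have hI : ∫ x, f x ∂P = 2 * a0 P Q + a0 Q P - 1 / 2 := by
    rw [hf, integral_sub h (integrable_const _), gK_int0]; simp
  have h1 := sq_integral_le_bdd hfi hf2
  have h2 : ∫ x, f x ^ 2 ∂P ≤ 4 * W := by
    have := integral_mono hf2 (integrable_const (4 * W)) hb
    simpa using this
  have e : gK P Q x = f x - ∫ x, f x ∂P := by rw [hI]; simp only [hf, gK]; ring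
  rw [e]
  nlinarith [hb x, sq_nonneg (f x + ∫ x, f x ∂P)]

lemma nap_of (h : ContinuityAssumption P Q) : NAP P ∧ NAP Q := by
  have key : ∀ (P : Measure (EuclideanSpace ℝ (Fin d))) (β : (EuclideanSpace ℝ (Fin d))) (t : ℝ), projLaw P β {t} = P {x | ⟪β, x⟫ = t} := by
    intro P β t
    unfold projLaw
    rw [Measure.map_apply (measurable_inner_left β) (measurableSet_singleton t)]
    rfl
  constructor
  · filter_upwards [h] with β hβ t
    rw [← key]; exact hβ.1 t
  · filter_upwards [h] with β hβ t
    rw [← key]; exact hβ.2 t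

end Hoeff

section Final
variable {d : ℕ}

/-- product-index family of measures -/
def muPQ (m n : ℕ) (P Q : Measure (EuclideanSpace ℝ (Fin d))) :
    Fin m ⊕ Fin n → Measure (EuclideanSpace ℝ (Fin d)) :=
  Sum.elim (fun _ => P) (fun _ => Q)

instance muPQ_prob (m n : ℕ) (P Q : Measure (EuclideanSpace ℝ (Fin d)))
    [IsProbabilityMeasure P] [IsProbabilityMeasure Q] (k : Fin m ⊕ Fin n) :
    IsProbabilityMeasure (muPQ m n P Q k) := by
  cases k <;> simp only [muPQ, Sum.elim_inl, Sum.elim_inr] <;> infer_instance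

lemma transfer (m n : ℕ) (P Q : Measure (EuclideanSpace ℝ (Fin d)))
    [IsProbabilityMeasure P] [IsProbabilityMeasure Q]
    (F : (Fin m → (EuclideanSpace ℝ (Fin d))) × (Fin n → (EuclideanSpace ℝ (Fin d))) → ℝ) :
    ∫ ω, F ω ∂((Measure.pi fun _ : Fin m => P).prod (Measure.pi fun _ : Fin n => Q)) =
    ∫ ω : Fin m ⊕ Fin n → (EuclideanSpace ℝ (Fin d)),
      F (fun i => ω (Sum.inl i), fun j => ω (Sum.inr j)) ∂(Measure.pi (muPQ m n P Q)) := by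
  have h := measurePreserving_sumPiEquivProdPi
    (X := fun _ : Fin m ⊕ Fin n => EuclideanSpace ℝ (Fin d)) (muPQ m n P Q)
  have := h.integral_comp' F
  exact this.symm

lemma UCvM_decomp (m n : ℕ) (hm : 3 ≤ m) (hn : 3 ≤ n) (P Q : Measure (EuclideanSpace ℝ (Fin d)))
    (ω : Fin m ⊕ Fin n → (EuclideanSpace ℝ (Fin d))) :
    UCvM m n (fun i => ω (Sum.inl i), fun j => ω (Sum.inr j)) = (1 / 3 - a0 P Q - a0 Q P) -
      (((m : ℝ) * (m - 1) * n)⁻¹ * ∑ t : Fin m × Fin m × Fin n, uterm Sum.inl Sum.inr (rK P Q) t ω +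
       ((n : ℝ) * (n - 1) * m)⁻¹ * ∑ t : Fin n × Fin n × Fin m, uterm Sum.inr Sum.inl (rK Q P) t ω +
       (m : ℝ)⁻¹ * ∑ i : Fin m, gK P Q (ω (Sum.inl i)) +
       (n : ℝ)⁻¹ * ∑ j : Fin n, gK Q P (ω (Sum.inr j))) := by
  have h1 := sum_alg1 hm hn (fun i1 i2 j => angK (ω (Sum.inl i1)) (ω (Sum.inl i2)) (ω (Sum.inr j)))
    (fun j1 j2 i => angK (ω (Sum.inr j1)) (ω (Sum.inr j2)) (ω (Sum.inl i)))
  have h2 := sum_alg2 hm hn (fun i1 i2 j => angK (ω (Sum.inl i1)) (ω (Sum.inl i2)) (ω (Sum.inr j)))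
    (fun i1 i2 j => rK P Q (ω (Sum.inl i1)) (ω (Sum.inl i2)) (ω (Sum.inr j)))
    (fun i => a1 P Q (ω (Sum.inl i))) (fun j => a3 P (ω (Sum.inr j))) (a0 P Q) (fun _ _ _ => rfl)
  have h3 := sum_alg2 hn hm (fun i1 i2 j => angK (ω (Sum.inr i1)) (ω (Sum.inr i2)) (ω (Sum.inl j)))
    (fun i1 i2 j => rK Q P (ω (Sum.inr i1)) (ω (Sum.inr i2)) (ω (Sum.inl j)))
    (fun i => a1 Q P (ω (Sum.inr i))) (fun j => a3 Q (ω (Sum.inl j))) (a0 Q P) (fun _ _ _ => rfl)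
  have hU : UCvM m n (fun i => ω (Sum.inl i), fun j => ω (Sum.inr j)) = _ := h1
  rw [hU, h2, h3]
  have hm' : (3 : ℝ) ≤ m := by exact_mod_cast hm
  have hn' : (3 : ℝ) ≤ n := by exact_mod_cast hn
  have g1 : (m : ℝ)⁻¹ * ∑ i : Fin m, gK P Q (ω (Sum.inl i)) =
      2 * ((m : ℝ)⁻¹ * ∑ i : Fin m, a1 P Q (ω (Sum.inl i))) + (m : ℝ)⁻¹ * ∑ i : Fin m, a3 Q (ω (Sum.inl i))
        - 2 * a0 P Q - a0 Q P := by
    simp only [gK, Finset.sum_sub_distrib, Finset.sum_add_distrib, ← Finset.mul_sum, Finset.sum_const,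
      Finset.card_univ, Fintype.card_fin, nsmul_eq_mul]
    have : (m : ℝ) ≠ 0 := by linarith
    field_simp
  have g2 : (n : ℝ)⁻¹ * ∑ i : Fin n, gK Q P (ω (Sum.inr i)) =
      2 * ((n : ℝ)⁻¹ * ∑ i : Fin n, a1 Q P (ω (Sum.inr i))) + (n : ℝ)⁻¹ * ∑ i : Fin n, a3 P (ω (Sum.inr i))
        - 2 * a0 Q P - a0 P Q := by
    simp only [gK, Finset.sum_sub_distrib, Finset.sum_add_distrib, ← Finset.mul_sum, Finset.sum_const,
      Finset.card_univ, Fintype.card_fin, nsmul_eq_mul]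
    have : (n : ℝ) ≠ 0 := by linarith
    field_simp
  rw [g1, g2]
  simp only [uterm]
  ring

lemma coef_bound (m n : ℕ) (hm : 3 ≤ m) (hn : 3 ≤ n) :
    (((m : ℝ) * (m - 1) * n)⁻¹) ^ 2 * (6 ^ 2 * (2 * (m : ℝ) ^ 2 * n ^ 2 + 4 * m ^ 3 * n)) ≤
      162 / (m : ℝ) ^ 2 + 324 / (m * n) := by
  have hm' : (3 : ℝ) ≤ m := by exact_mod_cast hm
  have hn' : (3 : ℝ) ≤ n := by exact_mod_cast hn
  have h1 : (m : ℝ) ≠ 0 := by linarith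
  have h2 : (n : ℝ) ≠ 0 := by linarith
  have h3 : (m : ℝ) - 1 ≠ 0 := by linarith
  have e : (((m : ℝ) * (m - 1) * n)⁻¹) ^ 2 * (6 ^ 2 * (2 * (m : ℝ) ^ 2 * n ^ 2 + 4 * m ^ 3 * n)) =
      (m / (m - 1)) ^ 2 * (72 / (m : ℝ) ^ 2 + 144 / (m * n)) := by
    field_simp
    ring
  have hq : ((m : ℝ) / (m - 1)) ^ 2 ≤ 9 / 4 := by
    have a : (m : ℝ) / (m - 1) ≤ 3 / 2 := by
      rw [div_le_div_iff₀ (by linarith) (by norm_num)]; linarith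
    have b : 0 ≤ (m : ℝ) / (m - 1) := div_nonneg (by linarith) (by linarith)
    nlinarith
  rw [e]
  have hp : 0 ≤ 72 / (m : ℝ) ^ 2 + 144 / (m * n) := by positivity
  calc _ ≤ 9 / 4 * (72 / (m : ℝ) ^ 2 + 144 / (m * n)) := mul_le_mul_of_nonneg_right hq hp
    _ = _ := by ring

lemma integrable_sum_bdd {Ω ι : Type*} [MeasurableSpace Ω] [Fintype ι] (ν : Measure Ω)
    [IsProbabilityMeasure ν] (c : ℝ) (f : ι → Ω → ℝ) (hf : ∀ i, Measurable (f i)) (C : ℝ)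
    (hb : ∀ i ω, |f i ω| ≤ C) :
    Integrable (fun ω => c * ∑ i, f i ω) ν ∧ Integrable (fun ω => (c * ∑ i, f i ω) ^ 2) ν := by
  have hm : Measurable (fun ω => c * ∑ i, f i ω) :=
    (Finset.measurable_fun_sum _ (fun i _ => hf i)).const_mul c
  have hB : ∀ ω, |c * ∑ i, f i ω| ≤ |c| * (Fintype.card ι * C) := by
    intro ω
    rw [abs_mul]
    refine mul_le_mul_of_nonneg_left ?_ (abs_nonneg _)
    refine (Finset.abs_sum_le_sum_abs _ _).trans ?_
    refine (Finset.sum_le_sum fun i _ => hb i ω).trans ?_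
    simp
  refine ⟨integrable_bdd hm _ hB, integrable_bdd (hm.pow_const 2) ((|c| * (Fintype.card ι * C)) ^ 2) ?_⟩
  intro ω
  rw [abs_pow]
  exact pow_le_pow_left₀ (abs_nonneg _) (hB ω) 2

lemma main_aux (m n : ℕ) (hm : 3 ≤ m) (hn : 3 ≤ n) (P Q : Measure (EuclideanSpace ℝ (Fin d)))
    [IsProbabilityMeasure P] [IsProbabilityMeasure Q] (hP : NAP P) (hQ : NAP Q) :
    ∫ ω, UCvM m n ω ∂((Measure.pi fun _ : Fin m => P).prod (Measure.pi fun _ : Fin n => Q))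
      = 1 / 3 - a0 P Q - a0 Q P ∧
    ∫ ω, (UCvM m n ω - (1 / 3 - a0 P Q - a0 Q P)) ^ 2
      ∂((Measure.pi fun _ : Fin m => P).prod (Measure.pi fun _ : Fin n => Q))
      ≤ 64 * (1 / 3 - a0 P Q - a0 Q P) * (1 / m + 1 / n)
              + 648 / m ^ 2 + 648 / n ^ 2 + 2592 / (m * n) := by
  rw [transfer, transfer]
  simp_rw [UCvM_decomp m n hm hn P Q]
  have hm' : (3 : ℝ) ≤ m := by exact_mod_cast hm
  have hn' : (3 : ℝ) ≤ n := by exact_mod_cast hn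
  set W := 1 / 3 - a0 P Q - a0 Q P with hW
  set ν := Measure.pi (muPQ m n P Q) with hν
  have hWs : 1 / 3 - a0 Q P - a0 P Q = W := by rw [hW]; ring
  have dA := rK_degen P Q
  have dB := rK_degen Q P
  have uvA : ∀ (i : Fin m) (j : Fin n), (Sum.inl i : Fin m ⊕ Fin n) ≠ Sum.inr j := by simp
  have uvB : ∀ (j : Fin n) (i : Fin m), (Sum.inr j : Fin m ⊕ Fin n) ≠ Sum.inl i := by simp
  have mP : ∀ i, muPQ m n P Q (Sum.inl i) = P := fun _ => rfl
  have mQ : ∀ i, muPQ m n P Q (Sum.inr i) = Q := fun _ => rfl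
  have injl : Function.Injective (Sum.inl : Fin m → Fin m ⊕ Fin n) := Sum.inl_injective
  have injr : Function.Injective (Sum.inr : Fin n → Fin m ⊕ Fin n) := Sum.inr_injective
  set A : (Fin m ⊕ Fin n → (EuclideanSpace ℝ (Fin d))) → ℝ := fun ω =>
    ((m : ℝ) * (m - 1) * n)⁻¹ * ∑ t : Fin m × Fin m × Fin n, uterm Sum.inl Sum.inr (rK P Q) t ω with hA
  set B : (Fin m ⊕ Fin n → (EuclideanSpace ℝ (Fin d))) → ℝ := fun ω =>
    ((n : ℝ) * (n - 1) * m)⁻¹ * ∑ t : Fin n × Fin n × Fin m, uterm Sum.inr Sum.inl (rK Q P) t ω with hB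
  set G : (Fin m ⊕ Fin n → (EuclideanSpace ℝ (Fin d))) → ℝ := fun ω =>
    (m : ℝ)⁻¹ * ∑ i : Fin m, gK P Q (ω (Sum.inl i)) with hG
  set H : (Fin m ⊕ Fin n → (EuclideanSpace ℝ (Fin d))) → ℝ := fun ω =>
    (n : ℝ)⁻¹ * ∑ j : Fin n, gK Q P (ω (Sum.inr j)) with hH
  have iA : Integrable A ν ∧ Integrable (fun ω => A ω ^ 2) ν :=
    integrable_sum_bdd ν _ _ (fun t => uterm_meas _ _ dA t) 6 (fun t => uterm_bdd _ _ dA t)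
  have iB : Integrable B ν ∧ Integrable (fun ω => B ω ^ 2) ν :=
    integrable_sum_bdd ν _ _ (fun t => uterm_meas _ _ dB t) 6 (fun t => uterm_bdd _ _ dB t)
  have gP : ∀ x, gK P Q x ^ 2 ≤ 16 * W := gK_sq P Q hP hQ
  have gQ : ∀ x, gK Q P x ^ 2 ≤ 16 * W := by rw [← hWs]; exact gK_sq Q P hQ hP
  have iG : Integrable G ν ∧ Integrable (fun ω => G ω ^ 2) ν :=
    integrable_sum_bdd ν _ (fun (i : Fin m) ω => gK P Q (ω (Sum.inl i)))
      (fun t => (measurable_gK P Q).comp (measurable_pi_apply _)) (√(16 * W))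
      (fun t ω => Real.abs_le_sqrt (gP _))
  have iH : Integrable H ν ∧ Integrable (fun ω => H ω ^ 2) ν :=
    integrable_sum_bdd ν _ (fun (i : Fin n) ω => gK Q P (ω (Sum.inr i)))
      (fun t => (measurable_gK Q P).comp (measurable_pi_apply _)) (√(16 * W))
      (fun t ω => Real.abs_le_sqrt (gQ _))
  have iAB : Integrable (fun ω => A ω + B ω) ν := iA.1.add iB.1
  have iABG : Integrable (fun ω => A ω + B ω + G ω) ν := iAB.add iG.1
  have iS : Integrable (fun ω => A ω + B ω + G ω + H ω) ν := iABG.add iH.1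
  -- means
  have eA : ∫ ω, A ω ∂ν = 0 := by
    rw [hA, integral_const_mul, integral_finsetSum]
    · rw [Finset.sum_eq_zero, mul_zero]
      intro t _
      exact uterm_mean _ _ _ dA injl uvA mP t
    · intro t _
      exact integrable_bdd (uterm_meas _ _ dA t) 6 (uterm_bdd _ _ dA t)
  have eB : ∫ ω, B ω ∂ν = 0 := by
    rw [hB, integral_const_mul, integral_finsetSum]
    · rw [Finset.sum_eq_zero, mul_zero]
      intro t _
      exact uterm_mean _ _ _ dB injr uvB mQ t
    · intro t _
      exact integrable_bdd (uterm_meas _ _ dB t) 6 (uterm_bdd _ _ dB t)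
  have eG : ∫ ω, G ω ∂ν = 0 := by
    rw [hG, integral_const_mul, integral_finsetSum]
    · rw [Finset.sum_eq_zero, mul_zero]
      intro t _
      exact lin_mean _ _ mP (measurable_gK P Q) (gK_int P Q) t
    · intro t _
      exact integrable_bdd ((measurable_gK P Q).comp (measurable_pi_apply _)) (√(16 * W))
        (fun ω => Real.abs_le_sqrt (gP _))
  have eH : ∫ ω, H ω ∂ν = 0 := by
    rw [hH, integral_const_mul, integral_finsetSum]
    · rw [Finset.sum_eq_zero, mul_zero]
      intro t _
      exact lin_mean _ _ mQ (measurable_gK Q P) (gK_int Q P) t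
    · intro t _
      exact integrable_bdd ((measurable_gK Q P).comp (measurable_pi_apply _)) (√(16 * W))
        (fun ω => Real.abs_le_sqrt (gQ _))
  -- variances
  have vA : ∫ ω, A ω ^ 2 ∂ν ≤ 162 / (m : ℝ) ^ 2 + 324 / (m * n) := by
    simp_rw [hA, mul_pow]
    rw [integral_const_mul]
    refine le_trans ?_ (coef_bound m n hm hn)
    exact mul_le_mul_of_nonneg_left (ustat_var _ _ _ dA injl injr uvA mP mQ) (sq_nonneg _)
  have vB : ∫ ω, B ω ^ 2 ∂ν ≤ 162 / (n : ℝ) ^ 2 + 324 / (n * m) := by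
    simp_rw [hB, mul_pow]
    rw [integral_const_mul]
    refine le_trans ?_ (coef_bound n m hn hm)
    exact mul_le_mul_of_nonneg_left (ustat_var _ _ _ dB injr injl uvB mQ mP) (sq_nonneg _)
  have vG : ∫ ω, G ω ^ 2 ∂ν ≤ 16 * W / m := by
    simp_rw [hG, mul_pow]
    rw [integral_const_mul]
    refine (mul_le_mul_of_nonneg_left (lin_var _ _ injl mP (measurable_gK P Q) (gK_int P Q) _ gP)
      (sq_nonneg _)).trans (le_of_eq ?_)
    have : (m : ℝ) ≠ 0 := by linarith
    field_simp
  have vH : ∫ ω, H ω ^ 2 ∂ν ≤ 16 * W / n := by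
    simp_rw [hH, mul_pow]
    rw [integral_const_mul]
    refine (mul_le_mul_of_nonneg_left (lin_var _ _ injr mQ (measurable_gK Q P) (gK_int Q P) _ gQ)
      (sq_nonneg _)).trans (le_of_eq ?_)
    have : (n : ℝ) ≠ 0 := by linarith
    field_simp
  constructor
  · have : ∫ ω, (W - (A ω + B ω + G ω + H ω)) ∂ν = W := by
      rw [integral_sub (integrable_const _) iS, integral_add iABG iH.1, integral_add iAB iG.1,
        integral_add iA.1 iB.1, eA, eB, eG, eH]
      simp
    exact this
  · have hle : ∀ ω, (W - (A ω + B ω + G ω + H ω) - W) ^ 2 ≤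
        4 * (A ω ^ 2 + B ω ^ 2 + G ω ^ 2 + H ω ^ 2) := by
      intro ω
      nlinarith [sq_nonneg (A ω - B ω), sq_nonneg (A ω - G ω), sq_nonneg (A ω - H ω),
        sq_nonneg (B ω - G ω), sq_nonneg (B ω - H ω), sq_nonneg (G ω - H ω)]
    have i2 : Integrable (fun ω => A ω ^ 2 + B ω ^ 2) ν := iA.2.add iB.2
    have i3 : Integrable (fun ω => A ω ^ 2 + B ω ^ 2 + G ω ^ 2) ν := i2.add iG.2
    have i4 : Integrable (fun ω => A ω ^ 2 + B ω ^ 2 + G ω ^ 2 + H ω ^ 2) ν := i3.add iH.2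
    have hmono : ∫ ω, (W - (A ω + B ω + G ω + H ω) - W) ^ 2 ∂ν ≤
        ∫ ω, 4 * (A ω ^ 2 + B ω ^ 2 + G ω ^ 2 + H ω ^ 2) ∂ν :=
      integral_mono_of_nonneg (Filter.Eventually.of_forall fun _ => sq_nonneg _) (i4.const_mul 4)
        (Filter.Eventually.of_forall hle)
    refine hmono.trans ?_
    rw [integral_const_mul, integral_add i3 iH.2, integral_add i2 iG.2, integral_add iA.2 iB.2]
    have hfin : 64 * W * (1 / m + 1 / n) + 648 / (m : ℝ) ^ 2 + 648 / (n : ℝ) ^ 2 + 2592 / (m * n) =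
        4 * ((162 / (m : ℝ) ^ 2 + 324 / (m * n)) + (162 / (n : ℝ) ^ 2 + 324 / (n * m)) + 16 * W / m
          + 16 * W / n) := by
      have h1 : (m : ℝ) ≠ 0 := by linarith
      have h2 : (n : ℝ) ≠ 0 := by linarith
      field_simp
      ring
    rw [hfin]
    linarith

end Final

/-- Unbiasedness and variance bound, Lemma for Theorem 4.2: there are
universal constants `C₁, C₂, C₃, C₄ > 0` such that for all `d`, all Borel probability measures
`P, Q` on `ℝ^d` satisfying the continuity assumption, every weight `ϑ ∈ (0,1)` and all
`m, n ≥ 3`, the `U`-statistic `U_CvM` built from i.i.d. samples `X₁,…,X_m ~ P` and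
(independently) `Y₁,…,Y_n ~ Q` satisfies `E[U_CvM] = W_d²(P,Q)` and
`Var(U_CvM) ≤ C₁ W_d²(P,Q) (1/m + 1/n) + C₂/m² + C₃/n² + C₄/(mn)`. -/
theorem stmt8 :
    ∃ C1 C2 C3 C4 : ℝ, 0 < C1 ∧ 0 < C2 ∧ 0 < C3 ∧ 0 < C4 ∧
      ∀ (d : ℕ) (P Q : Measure (EuclideanSpace ℝ (Fin d)))
        [IsProbabilityMeasure P] [IsProbabilityMeasure Q],
        ContinuityAssumption P Q →
        ∀ ϑ : ℝ, ϑ ∈ Set.Ioo (0 : ℝ) 1 → ∀ m n : ℕ, 3 ≤ m → 3 ≤ n →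
          (∫ ω, UCvM m n ω
              ∂((Measure.pi fun _ : Fin m => P).prod (Measure.pi fun _ : Fin n => Q)))
            = cvmSq ϑ P Q ∧
          (∫ ω, (UCvM m n ω - cvmSq ϑ P Q) ^ 2
              ∂((Measure.pi fun _ : Fin m => P).prod (Measure.pi fun _ : Fin n => Q)))
            ≤ C1 * cvmSq ϑ P Q * (1 / m + 1 / n)
              + C2 / m ^ 2 + C3 / n ^ 2 + C4 / (m * n) := by
  refine ⟨64, 648, 648, 2592, by norm_num, by norm_num, by norm_num, by norm_num, ?_⟩
  intro d P Q _ _ hc ϑ hϑ m n hm hn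
  obtain ⟨hP, hQ⟩ := nap_of P Q hc
  rw [cvmSq_eq P Q hP hQ ϑ hϑ]
  exact main_aux m n hm hn P Q hP hQ
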